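/- arXiv:2604.26728 — 2 statements merged into one kernel-verified Lean document; each statement's English description precedes it below -/
import Mathlib

section
/- Let α > -1, 1 ≤ p < ∞ and k ∈ ℕ, k ≥ 1. There exists a constant C = C(n,α,p,k) such that: if f ∈ C^∞(𝔹) and for every multi-index λ with |λ| = k-1 the average of ∂^λ f over the ball B_{1/2} vanishes, and this holds iteratively down to |λ| = 0 (i.e., for every multi-index λ with |λ| ≤ k-1, ∫_{B_{1/2}} ∂^λ f dν = 0), then ∫_𝔹 |f(x)|^p (1-|x|²)^α dν(x) ≤ C Σ_{|κ|=k} ∫_𝔹 |∂^κ f(x)|^p (1-|x|²)^{α+pk} dν(x). -/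
open MeasureTheory Metric

/-- Partial derivative in direction `i` of a function on `ℝⁿ`. -/
noncomputable def pdF {n : ℕ} (i : Fin n) (f : EuclideanSpace ℝ (Fin n) → ℝ) :
    EuclideanSpace ℝ (Fin n) → ℝ :=
  fun x => fderiv ℝ f x (EuclideanSpace.single i 1)

/-- Iterated partial derivative `∂^κ f` of multi-index order `κ`. -/
noncomputable def mderivF {n : ℕ} (κ : Fin n → ℕ)
    (f : EuclideanSpace ℝ (Fin n) → ℝ) : EuclideanSpace ℝ (Fin n) → ℝ :=
  (List.finRange n).foldl (fun g i => (pdF i)^[κ i] g) f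

lemma lintegral_rpow_le_of_weight {Ω : Type*} [MeasurableSpace Ω] {μ : Measure Ω} {p : ℝ}
    (hp : 1 ≤ p) {h : Ω → ENNReal} (hh : Measurable h) {u : Ω → ℝ} (hu : Measurable u)
    (hu0 : ∀ᵐ ω ∂μ, 0 < u ω) :
    (∫⁻ ω, h ω ∂μ) ^ p ≤
      (∫⁻ ω, ENNReal.ofReal (u ω) ∂μ) ^ (p - 1) *
        ∫⁻ ω, h ω ^ p * ENNReal.ofReal (u ω ^ (1 - p)) ∂μ := by
  have hp0 : 0 < p := by linarith
  set ν := μ.withDensity fun ω => ENNReal.ofReal (u ω) with hν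
  set φ : Ω → ENNReal := fun ω => h ω * ENNReal.ofReal (u ω)⁻¹ with hφ
  have hum : Measurable fun ω => ENNReal.ofReal (u ω) := hu.ennreal_ofReal
  have hφm : Measurable φ := hh.mul hu.inv.ennreal_ofReal
  have h1 : ∫⁻ ω, φ ω ∂ν = ∫⁻ ω, h ω ∂μ := by
    rw [hν, lintegral_withDensity_eq_lintegral_mul _ hum hφm]
    refine lintegral_congr_ae ?_
    filter_upwards [hu0] with ω hω
    simp only [Pi.mul_apply, hφ]
    rw [mul_left_comm, ← ENNReal.ofReal_mul hω.le, mul_inv_cancel₀ hω.ne']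
    simp
  have h2 : ∫⁻ ω, φ ω ^ p ∂ν = ∫⁻ ω, h ω ^ p * ENNReal.ofReal (u ω ^ (1 - p)) ∂μ := by
    rw [hν, lintegral_withDensity_eq_lintegral_mul _ hum (hφm.pow_const p)]
    refine lintegral_congr_ae ?_
    filter_upwards [hu0] with ω hω
    simp only [Pi.mul_apply, hφ]
    rw [ENNReal.mul_rpow_of_nonneg _ _ hp0.le, mul_left_comm,
      ENNReal.ofReal_rpow_of_pos (inv_pos.2 hω), ← ENNReal.ofReal_mul hω.le, Real.inv_rpow hω.le,
      Real.rpow_sub hω, Real.rpow_one, div_eq_mul_inv]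
  have h3 := eLpNorm'_le_eLpNorm'_mul_rpow_measure_univ (μ := ν) (f := φ) one_pos hp
    hφm.aestronglyMeasurable
  simp only [eLpNorm', enorm_eq_self, ENNReal.rpow_one, div_one] at h3
  rw [h1, h2, hν, withDensity_apply _ MeasurableSet.univ, Measure.restrict_univ] at h3
  calc _ ≤ _ := ENNReal.rpow_le_rpow h3 hp0.le
    _ = _ := by
      rw [ENNReal.mul_rpow_of_nonneg _ _ hp0.le, ← ENNReal.rpow_mul, ← ENNReal.rpow_mul, mul_comm]
      congr 2
      · field_simp
      · rw [one_div, inv_mul_cancel₀ hp0.ne', ENNReal.rpow_one]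

lemma lintegral_Ioc_half_sub_rpow {a b δ : ℝ} (hab : a ≤ b) (hδ : -1 < δ) :
    ∫⁻ t in Set.Ioc a b, ENNReal.ofReal (((t - a) / 2) ^ δ) =
      ENNReal.ofReal (2 * ((b - a) / 2) ^ (δ + 1) / (δ + 1)) := by
  have hi : IntervalIntegrable (fun t : ℝ => ((t - a) / 2) ^ δ) volume a b := by
    have h := (intervalIntegral.intervalIntegrable_rpow' (a := 0) (b := b - a) hδ).comp_sub_right a
    simp only [zero_add, sub_add_cancel] at h
    refine (h.div_const (2 ^ δ)).congr ?_
    intro t ht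
    rw [Set.uIoc_of_le hab] at ht
    simp only
    rw [Real.div_rpow (by linarith [ht.1]) (by norm_num)]
  rw [← ofReal_integral_eq_lintegral_ofReal ((intervalIntegrable_iff_integrableOn_Ioc_of_le hab).1 hi)]
  · congr 1
    rw [← intervalIntegral.integral_of_le hab,
      intervalIntegral.integral_comp_sub_right (fun t => (t / 2) ^ δ),
      intervalIntegral.integral_comp_div (fun t => t ^ δ) two_ne_zero, integral_rpow (Or.inl hδ)]
    simp [Real.zero_rpow (show δ + 1 ≠ 0 by linarith)]
    ring
  · refine (ae_restrict_iff' measurableSet_Ioc).2 (Filter.Eventually.of_forall fun t ht => ?_)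
    exact Real.rpow_nonneg (by linarith [ht.1]) _

lemma lintegral_Ioc_one_sub_add_rpow_le {d ε : ℝ} (hd : 0 < d) (hε : 0 < ε) :
    ∫⁻ t in Set.Ioc (0 : ℝ) 1, ENNReal.ofReal ((1 - t + d) ^ (-1 - ε)) ≤
      ENNReal.ofReal (d ^ (-ε) / ε) := by
  have h0 : (0 : ℝ) ∉ Set.uIcc d (1 + d) := by
    rw [Set.uIcc_of_le (by linarith)]
    exact fun h => by linarith [h.1]
  have hi : IntervalIntegrable (fun t : ℝ => (1 - t + d) ^ (-1 - ε)) volume 0 1 := by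
    refine ContinuousOn.intervalIntegrable fun t ht => ?_
    rw [Set.uIcc_of_le zero_le_one] at ht
    exact (ContinuousAt.rpow_const (by fun_prop) (Or.inl (by linarith [ht.2]))).continuousWithinAt
  rw [← ofReal_integral_eq_lintegral_ofReal
    ((intervalIntegrable_iff_integrableOn_Ioc_of_le zero_le_one).1 hi)]
  · refine ENNReal.ofReal_le_ofReal ?_
    rw [← intervalIntegral.integral_of_le zero_le_one]
    have : (∫ t in (0 : ℝ)..1, (1 - t + d) ^ (-1 - ε)) = ∫ t in d..(1 + d), t ^ (-1 - ε) := by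
      have := intervalIntegral.integral_comp_sub_left (fun t => t ^ (-1 - ε)) (1 + d)
        (a := 0) (b := 1)
      simp only [sub_zero, add_sub_cancel_left] at this
      rw [← this]
      congr 1; ext t; congr 1; ring
    rw [this, integral_rpow (Or.inr ⟨by linarith, h0⟩), show -1 - ε + 1 = -ε by ring, div_neg,
      ← neg_div]
    gcongr
    linarith [Real.rpow_nonneg (show 0 ≤ 1 + d by linarith) (-ε)]
  · refine (ae_restrict_iff' measurableSet_Ioc).2 (Filter.Eventually.of_forall fun t ht => ?_)
    exact Real.rpow_nonneg (by linarith [ht.2]) _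

section Segment

variable {E : Type*} [NormedAddCommGroup E] [NormedSpace ℝ E]

lemma one_sub_norm_segment_ge {x y : E} (hy : ‖y‖ ≤ 1 / 2) {s : ℝ} (h0 : 0 ≤ s) (h1 : s ≤ 1) :
    (1 - s) / 2 + s * (1 - ‖x‖) ≤ 1 - ‖y + s • (x - y)‖ := by
  have : ‖y + s • (x - y)‖ ≤ (1 - s) * ‖y‖ + s * ‖x‖ := by
    rw [show y + s • (x - y) = (1 - s) • y + s • x by module]
    refine (norm_add_le _ _).trans ?_
    rw [norm_smul, norm_smul, Real.norm_of_nonneg h0, Real.norm_of_nonneg (by linarith)]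
  nlinarith

lemma lintegral_ray_le [MeasurableSpace E] [BorelSpace E] {y z : E} (hy : ‖y‖ ≤ 1 / 2) {δ : ℝ}
    (hδ : -1 < δ) (hδ0 : δ ≤ 0) :
    ∫⁻ t in Set.Ioc (1 / 2 : ℝ) 1,
        (ball (0 : E) 1).indicator (fun x => ENNReal.ofReal ((1 - ‖x‖) ^ δ)) (y + t⁻¹ • (z - y)) ≤
      ENNReal.ofReal (2 / (δ + 1)) *
        (ball (0 : E) 1).indicator (fun x => ENNReal.ofReal ((1 - ‖x‖) ^ (δ + 1))) z := by
  set S : Set ℝ := {t | t ∈ Set.Ioc (1 / 2 : ℝ) 1 ∧ y + t⁻¹ • (z - y) ∈ ball (0 : E) 1} with hS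
  have key : ∀ s ∈ S, ∀ t, s ≤ t → t ≤ 1 → (t - s) / 2 < 1 - ‖y + t⁻¹ • (z - y)‖ := by
    rintro s ⟨⟨hs0, hs1⟩, hs⟩ t hst ht
    have ht0 : 0 < t := by linarith
    have hs0' : 0 < s := by linarith
    rw [mem_ball_zero_iff] at hs
    have h := one_sub_norm_segment_ge (x := y + s⁻¹ • (z - y)) hy (s := s / t) (by positivity)
      ((div_le_one ht0).2 hst)
    rw [show y + (s / t) • (y + s⁻¹ • (z - y) - y) = y + t⁻¹ • (z - y) by
      rw [add_sub_cancel_left, smul_smul]; congr 2; field_simp] at h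
    refine lt_of_lt_of_le ?_ h
    have h2 : 0 < s / t * (1 - ‖y + s⁻¹ • (z - y)‖) := mul_pos (by positivity) (by linarith)
    have h3 : t - s ≤ 1 - s / t := by
      rw [show t - s = t * (1 - s / t) by field_simp]
      have : 0 ≤ 1 - s / t := by linarith [(div_le_one ht0).2 hst]
      nlinarith
    linarith
  rcases S.eq_empty_or_nonempty with hE | ⟨s₀, hs₀⟩
  · rw [setLIntegral_congr_fun (g := fun _ => 0) measurableSet_Ioc, lintegral_zero]
    · exact zero_le
    · intro t ht
      refine Set.indicator_of_notMem (fun hb => ?_) _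
      have : t ∈ S := ⟨ht, hb⟩
      simp [hE] at this
  set a := sInf S with ha
  have hbdd : BddBelow S := ⟨1 / 2, fun t ht => ht.1.1.le⟩
  have ha1 : a ≤ 1 := (csInf_le hbdd hs₀).trans hs₀.1.2
  have key2 : ∀ t, a < t → t ≤ 1 → (t - a) / 2 ≤ 1 - ‖y + t⁻¹ • (z - y)‖ := by
    intro t hat ht
    refine le_of_forall_pos_le_add fun ε hε => ?_
    obtain ⟨s, hs, hsa⟩ := exists_lt_of_csInf_lt ⟨s₀, hs₀⟩ (show sInf S < min t (a + ε) from
      lt_min hat (by linarith))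
    have := key s hs t (hsa.le.trans (min_le_left _ _)) ht
    have := hsa.trans_le (min_le_right _ _)
    linarith
  have hz : z ∈ ball (0 : E) 1 := by
    have := key s₀ hs₀ 1 hs₀.1.2 le_rfl
    rw [inv_one, one_smul, add_sub_cancel] at this
    rw [mem_ball_zero_iff]
    linarith [hs₀.1.2]
  have hza : (1 - a) / 2 ≤ 1 - ‖z‖ := by
    rcases ha1.eq_or_lt with h | h
    · rw [mem_ball_zero_iff] at hz; rw [h]; linarith
    · simpa using key2 1 h le_rfl
  calc _ ≤ ∫⁻ t in Set.Ioc (1 / 2 : ℝ) 1, (Set.Ioc a 1).indicator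
          (fun t => ENNReal.ofReal (((t - a) / 2) ^ δ)) t := by
        refine lintegral_mono_ae ?_
        have hne : ∀ᵐ t : ℝ ∂(volume.restrict (Set.Ioc (1 / 2 : ℝ) 1)), t ≠ a :=
          ae_restrict_of_ae (Measure.ae_ne volume a)
        filter_upwards [hne, ae_restrict_mem measurableSet_Ioc] with t hta ht
        by_cases hb : y + t⁻¹ • (z - y) ∈ ball (0 : E) 1
        · have hat : a < t := lt_of_le_of_ne (csInf_le hbdd ⟨ht, hb⟩) (Ne.symm hta)
          rw [Set.indicator_of_mem hb, Set.indicator_of_mem (show t ∈ Set.Ioc a 1 from ⟨hat, ht.2⟩)]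
          exact ENNReal.ofReal_le_ofReal
            (Real.rpow_le_rpow_of_nonpos (by linarith) (key2 t hat ht.2) hδ0)
        · rw [Set.indicator_of_notMem hb]; exact zero_le
    _ ≤ ∫⁻ t in Set.Ioc a 1, ENNReal.ofReal (((t - a) / 2) ^ δ) :=
        (setLIntegral_le_lintegral _ _).trans_eq (lintegral_indicator measurableSet_Ioc _)
    _ ≤ _ := by
        rw [lintegral_Ioc_half_sub_rpow ha1 hδ, Set.indicator_of_mem hz,
          ← ENNReal.ofReal_mul (div_nonneg zero_le_two (by linarith))]
        refine ENNReal.ofReal_le_ofReal ?_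
        rw [div_mul_eq_mul_div]
        have : 0 < δ + 1 := by linarith
        gcongr

end Segment

/-- The power `(1 - ‖x‖) ^ δ` of the distance to the unit sphere. -/
noncomputable def sphereWeight {E : Type*} [NormedAddCommGroup E] (δ : ℝ) (x : E) :
    ENNReal := ENNReal.ofReal ((1 - ‖x‖) ^ δ)

lemma measurable_sphereWeight {E : Type*} [NormedAddCommGroup E]
    [MeasurableSpace E] [BorelSpace E] (δ : ℝ) :
    Measurable (sphereWeight (E := E) δ) :=
  ((measurable_const.sub measurable_norm).pow_const δ).ennreal_ofReal

section SegmentIntegrals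

variable {E : Type*} [NormedAddCommGroup E] [NormedSpace ℝ E]

lemma lintegral_comp_add_smul [MeasurableSpace E] [BorelSpace E] [FiniteDimensional ℝ E]
    (μ : Measure E) [μ.IsAddHaarMeasure] {F : E → ENNReal} (hF : Measurable F) (a : E) {t : ℝ}
    (ht : 0 < t) :
    ∫⁻ x, F (a + t • x) ∂μ =
      ENNReal.ofReal ((t ^ Module.finrank ℝ E)⁻¹) * ∫⁻ x, F x ∂μ := by
  rw [← lintegral_map (f := fun z => F (a + z)) (g := fun x : E => t • x)
    (hF.comp (measurable_const_add a)) (measurable_const_smul t),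
    Measure.map_addHaar_smul μ ht.ne', lintegral_smul_measure, lintegral_add_left_eq_self,
    abs_of_pos (by positivity), smul_eq_mul]

lemma lintegral_comp_add_smul_le [MeasurableSpace E] [BorelSpace E] [FiniteDimensional ℝ E]
    (μ : Measure E) [μ.IsAddHaarMeasure] {F : E → ENNReal} (hF : Measurable F) (a : E) {t : ℝ}
    (ht : 1 / 2 ≤ t) :
    ∫⁻ x, F (a + t • x) ∂μ ≤ 2 ^ Module.finrank ℝ E * ∫⁻ x, F x ∂μ := by
  rw [lintegral_comp_add_smul μ hF a (by linarith)]
  gcongr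
  rw [← inv_pow, ENNReal.ofReal_pow (by positivity)]
  gcongr
  rw [← ENNReal.ofReal_ofNat 2]
  refine ENNReal.ofReal_le_ofReal ?_
  rw [inv_le_comm₀ (by linarith) two_pos]
  linarith

variable [MeasurableSpace E] [BorelSpace E] [FiniteDimensional ℝ E]
    (μ : Measure E) [μ.IsAddHaarMeasure]

lemma lintegral_segment_far_le {y : E} (hy : ‖y‖ ≤ 1 / 2) {δ : ℝ} (hδ : -1 < δ) (hδ0 : δ ≤ 0)
    {H : E → ENNReal} (hH : Measurable H) :
    ∫⁻ x in ball (0 : E) 1, ∫⁻ t in Set.Ioc (1 / 2 : ℝ) 1,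
        H (y + t • (x - y)) * sphereWeight δ x ∂volume ∂μ ≤
      2 ^ Module.finrank ℝ E * ENNReal.ofReal (2 / (δ + 1)) *
        ∫⁻ z in ball (0 : E) 1, H z * sphereWeight (δ + 1) z ∂μ := by
  set W : E → ENNReal := (ball (0 : E) 1).indicator (sphereWeight δ) with hW
  have hWm : Measurable W := (measurable_sphereWeight δ).indicator measurableSet_ball
  have hray : ∀ z : E, ∫⁻ t in Set.Ioc (1 / 2 : ℝ) 1, W (y + t⁻¹ • (z - y)) ≤
      ENNReal.ofReal (2 / (δ + 1)) * (ball (0 : E) 1).indicator (sphereWeight (δ + 1)) z :=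
    fun z => lintegral_ray_le hy hδ hδ0
  calc _ = ∫⁻ t in Set.Ioc (1 / 2 : ℝ) 1, ∫⁻ x in ball (0 : E) 1,
          H (y + t • (x - y)) * sphereWeight δ x ∂μ := by
        refine lintegral_lintegral_swap (Measurable.aemeasurable ?_)
        have := measurable_sphereWeight (E := E) δ
        simp only [Function.uncurry_def]
        exact (hH.comp (by fun_prop)).mul (this.comp measurable_fst)
    _ ≤ ∫⁻ t in Set.Ioc (1 / 2 : ℝ) 1, 2 ^ Module.finrank ℝ E *
          ∫⁻ z, W (y + t⁻¹ • (z - y)) * H z ∂μ := by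
        refine setLIntegral_mono' measurableSet_Ioc fun t ht => ?_
        refine le_trans (le_of_eq ?_) (lintegral_comp_add_smul_le μ
          (F := fun z => W (y + t⁻¹ • (z - y)) * H z) ?_ ((1 - t) • y) ht.1.le)
        · rw [← lintegral_indicator measurableSet_ball]
          refine lintegral_congr fun x => ?_
          have h1 : (1 - t) • y + t • x = y + t • (x - y) := by module
          have h2 : y + t⁻¹ • (y + t • (x - y) - y) = x := by
            rw [add_sub_cancel_left, inv_smul_smul₀ (by linarith [ht.1] : t ≠ 0), add_sub_cancel]
          rw [h1, h2, hW, mul_comm]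
          by_cases hx : x ∈ ball (0 : E) 1 <;> simp only [hx, Set.indicator_of_mem,
            not_false_eq_true, Set.indicator_of_notMem, mul_zero]
        · exact (hWm.comp (by fun_prop)).mul hH
    _ = 2 ^ Module.finrank ℝ E *
          ∫⁻ z, ∫⁻ t in Set.Ioc (1 / 2 : ℝ) 1, W (y + t⁻¹ • (z - y)) * H z ∂volume ∂μ := by
        rw [lintegral_const_mul' _ _ (by finiteness), lintegral_lintegral_swap]
        refine Measurable.aemeasurable ?_
        simp only [Function.uncurry_def]
        exact (hWm.comp (by fun_prop)).mul (hH.comp measurable_snd)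
    _ ≤ 2 ^ Module.finrank ℝ E * ∫⁻ z, ENNReal.ofReal (2 / (δ + 1)) *
          (ball (0 : E) 1).indicator (fun z => H z * sphereWeight (δ + 1) z) z ∂μ := by
        gcongr with z
        have hm : Measurable fun t : ℝ => W (y + t⁻¹ • (z - y)) := hWm.comp (by fun_prop)
        rw [lintegral_mul_const _ hm]
        refine (mul_le_mul_left (hray z) _).trans_eq ?_
        by_cases hz : z ∈ ball (0 : E) 1
        · simp only [hz, Set.indicator_of_mem]; ring
        · simp [Set.indicator_of_notMem hz]
    _ = _ := by
        rw [lintegral_const_mul' _ _ (by finiteness), lintegral_indicator measurableSet_ball,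
          mul_assoc]

lemma lintegral_sphereWeight_lt_top {δ : ℝ} (hδ : -1 < δ) (hδ0 : δ ≤ 0) :
    ∫⁻ x in ball (0 : E) 1, sphereWeight δ x ∂μ < ⊤ := by
  have h := lintegral_segment_far_le μ (y := (0 : E)) (by simp) hδ hδ0
    (H := fun _ => 1) measurable_const
  have h1 : ∫⁻ z in ball (0 : E) 1, 1 * sphereWeight (δ + 1) z ∂μ ≤ μ (ball 0 1) := by
    rw [← setLIntegral_one]
    refine setLIntegral_mono' measurableSet_ball fun z hz => ?_
    rw [mem_ball_zero_iff] at hz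
    rw [one_mul, sphereWeight, ENNReal.ofReal_le_one]
    exact Real.rpow_le_one (by linarith) (by linarith [norm_nonneg z]) (by linarith)
  have h2 : ∫⁻ x in ball (0 : E) 1, ∫⁻ t in Set.Ioc (1 / 2 : ℝ) 1, 1 * sphereWeight δ x ∂volume ∂μ =
      ENNReal.ofReal (1 / 2) * ∫⁻ x in ball (0 : E) 1, sphereWeight δ x ∂μ := by
    simp only [one_mul, lintegral_const, Measure.restrict_apply_univ, Real.volume_Ioc]
    rw [lintegral_mul_const' _ _ (by finiteness), mul_comm]
    norm_num
  rw [h2] at h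
  have h3 := h.trans_lt ((mul_le_mul_right h1 _).trans_lt
    (by have := measure_ball_lt_top (μ := μ) (x := (0 : E)) (r := 1); finiteness))
  by_contra! h4
  rw [top_le_iff.1 h4, ENNReal.mul_top (by simp)] at h3
  exact lt_irrefl _ h3

lemma lintegral_segment_near_le {x : E} (hx : ‖x‖ ≤ 1) {γ : ℝ} (hγ : 0 ≤ γ)
    {H : E → ENNReal} (hH : Measurable H) :
    ∫⁻ y in ball (0 : E) (1 / 2), ∫⁻ t in Set.Ioc (0 : ℝ) (1 / 2), H (y + t • (x - y)) ∂volume ∂μ ≤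
      2 ^ Module.finrank ℝ E * ENNReal.ofReal (4 ^ γ) *
        ∫⁻ z in ball (0 : E) 1, H z * sphereWeight γ z ∂μ := by
  set G : E → ENNReal := (ball (0 : E) 1).indicator (fun z => H z * sphereWeight γ z) with hG
  have hGm : Measurable G := (hH.mul (measurable_sphereWeight γ)).indicator measurableSet_ball
  calc _ = ∫⁻ t in Set.Ioc (0 : ℝ) (1 / 2), ∫⁻ y in ball (0 : E) (1 / 2),
          H (y + t • (x - y)) ∂μ := by
        refine lintegral_lintegral_swap (Measurable.aemeasurable ?_)
        simp only [Function.uncurry_def]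
        exact hH.comp (by fun_prop)
    _ ≤ ∫⁻ t in Set.Ioc (0 : ℝ) (1 / 2), ENNReal.ofReal (4 ^ γ) *
          (2 ^ Module.finrank ℝ E * ∫⁻ z, G z ∂μ) := by
        refine setLIntegral_mono' measurableSet_Ioc fun t ht => ?_
        refine le_trans ?_ (mul_le_mul_right (lintegral_comp_add_smul_le μ hGm (t • x)
          (t := 1 - t) (by linarith [ht.2])) _)
        rw [← lintegral_const_mul' _ _ (by finiteness)]
        refine le_trans (setLIntegral_mono' measurableSet_ball fun y hy => ?_)
          (setLIntegral_le_lintegral (ball (0 : E) (1 / 2)) _)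
        rw [mem_ball_zero_iff] at hy
        have h := one_sub_norm_segment_ge (x := x) hy.le ht.1.le (by linarith [ht.2])
        rw [show t • x + (1 - t) • y = y + t • (x - y) by module]
        have h4 : 1 / 4 ≤ 1 - ‖y + t • (x - y)‖ := by nlinarith [ht.1, ht.2]
        rw [hG, Set.indicator_of_mem (by rw [mem_ball_zero_iff]; linarith), mul_left_comm]
        refine le_mul_of_one_le_right zero_le ?_
        rw [sphereWeight, ← ENNReal.ofReal_mul (by positivity), ENNReal.one_le_ofReal,
          ← Real.mul_rpow (by norm_num) (by linarith)]
        exact Real.one_le_rpow (by linarith) hγ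
    _ ≤ ENNReal.ofReal (4 ^ γ) * (2 ^ Module.finrank ℝ E * ∫⁻ z, G z ∂μ) := by
        rw [lintegral_const]
        refine mul_le_of_le_one_right zero_le ?_
        simp only [Measure.restrict_apply_univ, Real.volume_Ioc, ENNReal.ofReal_le_one]
        norm_num
    _ = _ := by
        rw [hG, lintegral_indicator measurableSet_ball]; ring

lemma exists_lintegral_segment_le {δ : ℝ} (hδ : -1 < δ) (hδ0 : δ ≤ 0) :
    ∃ C : ENNReal, C < ⊤ ∧ ∀ H : E → ENNReal, Measurable H →
      ∫⁻ x in ball (0 : E) 1, ∫⁻ y in ball (0 : E) (1 / 2), ∫⁻ t in Set.Ioc (0 : ℝ) 1,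
          H (y + t • (x - y)) * sphereWeight δ x ∂volume ∂μ ∂μ ≤
        C * ∫⁻ z in ball (0 : E) 1, H z * sphereWeight (δ + 1) z ∂μ := by
  have hI := lintegral_sphereWeight_lt_top μ hδ hδ0
  set I := ∫⁻ x in ball (0 : E) 1, sphereWeight δ x ∂μ
  have hV : μ (ball (0 : E) (1 / 2)) < ⊤ := measure_ball_lt_top
  set N : ENNReal := 2 ^ Module.finrank ℝ E
  have hN : N < ⊤ := by finiteness
  refine ⟨I * (N * ENNReal.ofReal (4 ^ (δ + 1))) +
    μ (ball (0 : E) (1 / 2)) * (N * ENNReal.ofReal (2 / (δ + 1))), by finiteness,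
    fun H hH => ?_⟩
  set R := ∫⁻ z in ball (0 : E) 1, H z * sphereWeight (δ + 1) z ∂μ
  have hw := measurable_sphereWeight (E := E) δ
  have hsplit : Set.Ioc (0 : ℝ) 1 = Set.Ioc 0 (1 / 2) ∪ Set.Ioc (1 / 2) 1 :=
    (Set.Ioc_union_Ioc_eq_Ioc (by norm_num) (by norm_num)).symm
  have hm3 : ∀ s : Set ℝ, Measurable fun q : E × E => ∫⁻ t in s,
      H (q.2 + t • (q.1 - q.2)) * sphereWeight δ q.1 := fun s => by
    refine Measurable.lintegral_prod_right' (f := fun q : (E × E) × ℝ =>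
      H (q.1.2 + q.2 • (q.1.1 - q.1.2)) * sphereWeight δ q.1.1) ?_
    exact (hH.comp (by fun_prop)).mul (hw.comp (by fun_prop))
  have hm2 : ∀ s : Set ℝ, Measurable fun x : E => ∫⁻ y in ball (0 : E) (1 / 2), ∫⁻ t in s,
      H (y + t • (x - y)) * sphereWeight δ x ∂volume ∂μ := fun s =>
    Measurable.lintegral_prod_right' (hm3 s)
  calc _ = (∫⁻ x in ball (0 : E) 1, ∫⁻ y in ball (0 : E) (1 / 2), ∫⁻ t in Set.Ioc (0 : ℝ) (1 / 2),
          H (y + t • (x - y)) * sphereWeight δ x ∂volume ∂μ ∂μ) +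
        ∫⁻ x in ball (0 : E) 1, ∫⁻ y in ball (0 : E) (1 / 2), ∫⁻ t in Set.Ioc (1 / 2 : ℝ) 1,
          H (y + t • (x - y)) * sphereWeight δ x ∂volume ∂μ ∂μ := by
        rw [← lintegral_add_left (hm2 _)]
        refine lintegral_congr fun x => ?_
        have hm : Measurable fun y => ∫⁻ t in Set.Ioc (0 : ℝ) (1 / 2),
            H (y + t • (x - y)) * sphereWeight δ x := (hm3 _).comp measurable_prodMk_left
        rw [← lintegral_add_left hm]
        refine lintegral_congr fun y => ?_
        rw [hsplit, lintegral_union measurableSet_Ioc]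
        exact Set.disjoint_left.2 fun t ht ht' => absurd ht.2 (not_le.2 ht'.1)
    _ ≤ (∫⁻ x in ball (0 : E) 1, sphereWeight δ x * (N * ENNReal.ofReal (4 ^ (δ + 1)) * R) ∂μ) +
        ∫⁻ _ in ball (0 : E) (1 / 2), N * ENNReal.ofReal (2 / (δ + 1)) * R ∂μ := by
        refine add_le_add ?_ ?_
        · refine setLIntegral_mono' measurableSet_ball fun x hx => ?_
          rw [mem_ball_zero_iff] at hx
          refine le_trans (le_of_eq ?_) (mul_le_mul_right
            (lintegral_segment_near_le μ hx.le (γ := δ + 1) (by linarith) hH) _)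
          have hfin : sphereWeight δ x ≠ ⊤ := ENNReal.ofReal_ne_top
          simp_rw [lintegral_mul_const' _ _ hfin]
          rw [mul_comm]
        · rw [lintegral_lintegral_swap (hm3 _).aemeasurable]
          refine setLIntegral_mono' measurableSet_ball fun y hy => ?_
          rw [mem_ball_zero_iff] at hy
          exact lintegral_segment_far_le μ hy.le hδ hδ0 hH
    _ = _ := by
        rw [lintegral_mul_const _ hw, setLIntegral_const]
        ring

end SegmentIntegrals

lemma weight_product_le {d w e ε p δ : ℝ} (hd : 0 < d) (hdw : d ≤ w) (hwe : w ≤ 4 * e) (hε : 0 < ε)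
    (hp : 1 ≤ p) :
    d ^ (δ + ε * p) * (d ^ (-ε) / ε) ^ (p - 1) * (w ^ (-1 - ε)) ^ (1 - p) ≤
      (ε⁻¹ ^ (p - 1) * 4 ^ (p - 1 + ε * p)) * (e ^ (p - 1 + ε * p) * d ^ δ) := by
  have hw : 0 < w := hd.trans_le hdw
  have he : 0 < e := by linarith
  have h1 : d ^ (δ + ε * p) * (d ^ (-ε) / ε) ^ (p - 1) * (w ^ (-1 - ε)) ^ (1 - p) =
      ε⁻¹ ^ (p - 1) * d ^ δ * (d ^ ε * w ^ ((-1 - ε) * (1 - p))) := by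
    rw [div_eq_mul_inv, Real.mul_rpow (by positivity) (by positivity), ← Real.rpow_mul hd.le,
      ← Real.rpow_mul hw.le, show δ + ε * p = δ + ε + ε * (p - 1) by ring, Real.rpow_add hd,
      Real.rpow_add hd, show -ε * (p - 1) = -(ε * (p - 1)) by ring, Real.rpow_neg hd.le]
    have : d ^ (ε * (p - 1)) ≠ 0 := by positivity
    field_simp
  rw [h1]
  calc _ ≤ ε⁻¹ ^ (p - 1) * d ^ δ * (w ^ ε * w ^ ((-1 - ε) * (1 - p))) := by gcongr
    _ = ε⁻¹ ^ (p - 1) * d ^ δ * w ^ (p - 1 + ε * p) := by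
      rw [← Real.rpow_add hw]; congr 2; ring
    _ ≤ ε⁻¹ ^ (p - 1) * d ^ δ * (4 * e) ^ (p - 1 + ε * p) := by
      gcongr
    _ = _ := by rw [Real.mul_rpow (by norm_num) he.le]; ring

section Poincare

variable {E : Type*} [NormedAddCommGroup E] [NormedSpace ℝ E]

lemma enorm_sub_le_lintegral_fderiv_segment {g : E → ℝ} (hg : ContDiffOn ℝ 1 g (ball 0 1))
    {x y : E} (hx : x ∈ ball (0 : E) 1) (hy : y ∈ ball (0 : E) 1) :
    ‖g x - g y‖ₑ ≤ ∫⁻ t in Set.Ioc (0 : ℝ) 1, 2 * ‖fderiv ℝ g (y + t • (x - y))‖ₑ := by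
  have hmem : ∀ t ∈ Set.Icc (0 : ℝ) 1, y + t • (x - y) ∈ ball (0 : E) 1 := fun t ht =>
    (convex_ball (0 : E) 1).add_smul_sub_mem hy hx ht
  have hφ : ContDiffOn ℝ 1 (fun t : ℝ => g (y + t • (x - y))) (Set.Icc 0 1) :=
    hg.comp (by fun_prop) hmem
  have h := enorm_sub_le_lintegral_deriv_of_contDiffOn_Icc hφ zero_le_one
  simp only [one_smul, zero_smul, add_zero, add_sub_cancel] at h
  rw [restrict_Ioc_eq_restrict_Icc]
  refine h.trans (setLIntegral_mono' measurableSet_Icc fun t ht => ?_)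
  have hd : HasFDerivAt g (fderiv ℝ g (y + t • (x - y))) (y + t • (x - y)) :=
    ((hg.differentiableOn one_ne_zero).differentiableAt
      (isOpen_ball.mem_nhds (hmem t ht))).hasFDerivAt
  have hl : HasDerivAt (fun t : ℝ => y + t • (x - y)) (x - y) t := by
    simpa using ((hasDerivAt_id t).smul_const (x - y)).const_add y
  have hc : HasDerivAt (fun t : ℝ => g (y + t • (x - y)))
      (fderiv ℝ g (y + t • (x - y)) (x - y)) t := hd.comp_hasDerivAt t hl
  rw [hc.deriv, mul_comm]
  refine (ContinuousLinearMap.le_opENorm _ _).trans ?_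
  gcongr
  rw [← ofReal_norm, ← ENNReal.ofReal_ofNat 2]
  refine ENNReal.ofReal_le_ofReal ((norm_sub_le _ _).trans ?_)
  rw [mem_ball_zero_iff] at hx hy
  linarith

variable [MeasurableSpace E] [BorelSpace E] [FiniteDimensional ℝ E]
    (μ : Measure E) [μ.IsAddHaarMeasure]

lemma enorm_mul_measure_half_ball_le {g : E → ℝ} (hg : ContDiffOn ℝ 1 g (ball 0 1))
    (h0 : ∫ y in ball (0 : E) (1 / 2), g y ∂μ = 0) {x : E} (hx : x ∈ ball (0 : E) 1) :
    ‖g x‖ₑ * μ (ball (0 : E) (1 / 2)) ≤ ∫⁻ y in ball (0 : E) (1 / 2),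
      ∫⁻ t in Set.Ioc (0 : ℝ) 1, 2 * ‖fderiv ℝ g (y + t • (x - y))‖ₑ ∂volume ∂μ := by
  have hsub : closedBall (0 : E) (1 / 2) ⊆ ball 0 1 := closedBall_subset_ball (by norm_num)
  have hgi : IntegrableOn g (ball (0 : E) (1 / 2)) μ :=
    ((hg.continuousOn.mono hsub).integrableOn_compact (isCompact_closedBall _ _)).mono_set
      ball_subset_closedBall
  have hV : μ (ball (0 : E) (1 / 2)) < ⊤ := measure_ball_lt_top
  have h1 : ∫ y in ball (0 : E) (1 / 2), (g x - g y) ∂μ = μ.real (ball (0 : E) (1 / 2)) * g x := by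
    have hc : Integrable (fun _ => g x) (μ.restrict (ball (0 : E) (1 / 2))) :=
      integrableOn_const hV.ne (by simp)
    rw [integral_sub hc hgi, h0, setIntegral_const, sub_zero, smul_eq_mul]
  calc _ = ‖∫ y in ball (0 : E) (1 / 2), (g x - g y) ∂μ‖ₑ := by
        rw [h1, enorm_mul, mul_comm, Measure.real, Real.enorm_of_nonneg ENNReal.toReal_nonneg,
          ENNReal.ofReal_toReal hV.ne]
    _ ≤ ∫⁻ y in ball (0 : E) (1 / 2), ‖g x - g y‖ₑ ∂μ := enorm_integral_le_lintegral_enorm _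
    _ ≤ _ := setLIntegral_mono' measurableSet_ball fun y hy =>
        enorm_sub_le_lintegral_fderiv_segment hg hx (ball_subset_ball (by norm_num) hy)

lemma exists_weighted_poincare {α p : ℝ} (hα : -1 < α) (hp : 1 ≤ p) :
    ∃ C : ENNReal, C < ⊤ ∧ ∀ g : E → ℝ, ContDiffOn ℝ 1 g (ball 0 1) →
      ∫ y in ball (0 : E) (1 / 2), g y ∂μ = 0 →
      ∫⁻ x in ball (0 : E) 1, ‖g x‖ₑ ^ p * sphereWeight α x ∂μ ≤
        C * ∫⁻ x in ball (0 : E) 1, ‖fderiv ℝ g x‖ₑ ^ p * sphereWeight (α + p) x ∂μ := by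
  have hp0 : 0 < p := by linarith
  obtain ⟨δ, hδ, hδ0, hδα⟩ : ∃ δ : ℝ, -1 < δ ∧ δ ≤ 0 ∧ δ < α := by
    refine ⟨(min α 0 - 1) / 2, ?_, ?_, ?_⟩ <;> rcases le_total α 0 with h | h <;>
      simp only [h, min_eq_left, min_eq_right] <;> linarith
  obtain ⟨ε, hε, rfl⟩ : ∃ ε : ℝ, 0 < ε ∧ δ + ε * p = α :=
    ⟨(α - δ) / p, div_pos (by linarith) hp0, by field_simp; ring⟩
  set γ := p - 1 + ε * p with hγ
  obtain ⟨C, hC, hseg⟩ := exists_lintegral_segment_le μ hδ hδ0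
  set V := μ (ball (0 : E) (1 / 2))
  have hV : V ≠ ⊤ := measure_ball_lt_top.ne
  have hV0 : V ≠ 0 := (measure_ball_pos μ _ (by norm_num)).ne'
  set K : ENNReal := ENNReal.ofReal (ε⁻¹ ^ (p - 1) * 4 ^ γ)
  have hK : K ≠ ⊤ := ENNReal.ofReal_ne_top
  have hVp : (V ^ p)⁻¹ ≠ ⊤ := ENNReal.inv_ne_top.2 (by simp [ENNReal.rpow_eq_zero_iff, hV, hV0])
  refine ⟨(V ^ p)⁻¹ * (V ^ (p - 1) * (2 ^ p * K) * C), ?_, fun g hg h0 => ?_⟩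
  · have : V ^ (p - 1) ≠ ⊤ := ENNReal.rpow_ne_top_of_nonneg (by linarith) hV
    have : (2 : ENNReal) ^ p ≠ ⊤ := ENNReal.rpow_ne_top_of_nonneg (by linarith) (by simp)
    finiteness
  have hGm : Measurable fun z : E => ‖fderiv ℝ g z‖ₑ := (measurable_fderiv ℝ g).enorm
  set H : E → ENNReal := fun z => ‖fderiv ℝ g z‖ₑ ^ p * sphereWeight γ z with hH
  have hHm : Measurable H := (hGm.pow_const p).mul (measurable_sphereWeight γ)
  have hpt : ∀ x ∈ ball (0 : E) 1, ‖g x‖ₑ ^ p * sphereWeight (δ + ε * p) x ≤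
      (V ^ p)⁻¹ * (V ^ (p - 1) * (2 ^ p * K) * ∫⁻ y in ball (0 : E) (1 / 2),
        ∫⁻ t in Set.Ioc (0 : ℝ) 1, H (y + t • (x - y)) * sphereWeight δ x ∂volume ∂μ) := by
    intro x hx
    have hx1 : 0 < 1 - ‖x‖ := by rw [mem_ball_zero_iff] at hx; linarith
    set A : E → ENNReal := fun y =>
      ∫⁻ t in Set.Ioc (0 : ℝ) 1, 2 * ‖fderiv ℝ g (y + t • (x - y))‖ₑ with hA
    have hAm : Measurable A := by
      refine Measurable.lintegral_prod_right' (f := fun q : E × ℝ =>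
        2 * ‖fderiv ℝ g (q.1 + q.2 • (x - q.1))‖ₑ) ?_
      exact (hGm.comp (by fun_prop)).const_mul 2
    have hAp : ∀ y ∈ ball (0 : E) (1 / 2), A y ^ p * sphereWeight (δ + ε * p) x ≤
        2 ^ p * K * ∫⁻ t in Set.Ioc (0 : ℝ) 1, H (y + t • (x - y)) * sphereWeight δ x := by
      intro y hy
      rw [mem_ball_zero_iff] at hy
      have hJ := lintegral_rpow_le_of_weight (μ := volume.restrict (Set.Ioc (0 : ℝ) 1)) hp
        (h := fun t => 2 * ‖fderiv ℝ g (y + t • (x - y))‖ₑ)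
        (u := fun t => (1 - t + (1 - ‖x‖)) ^ (-1 - ε))
        ((hGm.comp (by fun_prop)).const_mul 2)
        (((measurable_const.sub measurable_id).add_const _).pow_const _) (by
          filter_upwards [ae_restrict_mem measurableSet_Ioc] with t ht
          exact Real.rpow_pos_of_pos (by linarith [ht.2]) _)
      have hw := ENNReal.rpow_le_rpow (lintegral_Ioc_one_sub_add_rpow_le hx1 hε)
        (show 0 ≤ p - 1 by linarith)
      rw [ENNReal.ofReal_rpow_of_pos (by positivity)] at hw
      calc _ ≤ ENNReal.ofReal (((1 - ‖x‖) ^ (-ε) / ε) ^ (p - 1)) *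
            (∫⁻ t in Set.Ioc (0 : ℝ) 1, (2 * ‖fderiv ℝ g (y + t • (x - y))‖ₑ) ^ p *
              ENNReal.ofReal (((1 - t + (1 - ‖x‖)) ^ (-1 - ε)) ^ (1 - p))) *
              sphereWeight (δ + ε * p) x := by
            gcongr
            exact hJ.trans (mul_le_mul_left hw _)
        _ = ∫⁻ t in Set.Ioc (0 : ℝ) 1, ENNReal.ofReal (((1 - ‖x‖) ^ (-ε) / ε) ^ (p - 1)) *
            ((2 * ‖fderiv ℝ g (y + t • (x - y))‖ₑ) ^ p *
              ENNReal.ofReal (((1 - t + (1 - ‖x‖)) ^ (-1 - ε)) ^ (1 - p))) *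
              sphereWeight (δ + ε * p) x := by
            have hsw : sphereWeight (δ + ε * p) x ≠ ⊤ := ENNReal.ofReal_ne_top
            rw [lintegral_mul_const' _ _ hsw,
              lintegral_const_mul' _ _ ENNReal.ofReal_ne_top]
        _ ≤ ∫⁻ t in Set.Ioc (0 : ℝ) 1, 2 ^ p * K *
              (H (y + t • (x - y)) * sphereWeight δ x) := by
            refine setLIntegral_mono' measurableSet_Ioc fun t ht => ?_
            have hz := one_sub_norm_segment_ge (x := x) hy.le ht.1.le ht.2
            have hwe : 1 - t + (1 - ‖x‖) ≤ 4 * (1 - ‖y + t • (x - y)‖) := by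
              rcases le_total (1 / 4) t with h | h
              · nlinarith [mul_nonneg (sub_nonneg.2 h) hx1.le, ht.2]
              · nlinarith [mul_nonneg (sub_nonneg.2 h) (norm_nonneg x), ht.1]
            have hmain := ENNReal.ofReal_le_ofReal (weight_product_le (δ := δ) hx1
              (by linarith [ht.2] : 1 - ‖x‖ ≤ 1 - t + (1 - ‖x‖)) hwe hε hp)
            have he : 0 ≤ 1 - ‖y + t • (x - y)‖ := by nlinarith [ht.1, ht.2]
            have hwt : 0 < 1 - t + (1 - ‖x‖) := by linarith [ht.2]
            rw [ENNReal.ofReal_mul (by positivity), ENNReal.ofReal_mul (by positivity),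
              ENNReal.ofReal_mul (by positivity),
              ENNReal.ofReal_mul (p := (1 - ‖y + t • (x - y)‖) ^ (p - 1 + ε * p))
                (by positivity)] at hmain
            rw [ENNReal.mul_rpow_of_nonneg _ _ hp0.le]
            refine le_trans (le_of_eq ?_) ((mul_le_mul_right hmain
              (2 ^ p * ‖fderiv ℝ g (y + t • (x - y))‖ₑ ^ p)).trans_eq ?_)
            · simp only [sphereWeight]; ring
            · simp only [sphereWeight, hH, K, hγ]; ring
        _ = _ := by rw [lintegral_const_mul' _ _ (by finiteness)]
    have hJ := lintegral_rpow_le_of_weight (μ := μ.restrict (ball (0 : E) (1 / 2))) hp hAm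
      (u := fun _ => 1) measurable_const (by simp)
    simp only [ENNReal.ofReal_one, Real.one_rpow, mul_one, setLIntegral_one] at hJ
    have h1 := (ENNReal.rpow_le_rpow (enorm_mul_measure_half_ball_le μ hg h0 hx) hp0.le).trans hJ
    rw [ENNReal.mul_rpow_of_nonneg _ _ hp0.le] at h1
    rw [← ENNReal.mul_le_iff_le_inv (by simp [ENNReal.rpow_eq_zero_iff, hV, hV0])
      (ENNReal.rpow_ne_top_of_nonneg hp0.le hV), ← mul_assoc, mul_comm (V ^ p)]
    refine (mul_le_mul_left h1 _).trans ?_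
    rw [mul_assoc, mul_assoc (V ^ (p - 1)), ← lintegral_const_mul' _ _ (by finiteness),
      ← lintegral_mul_const' _ _ (by exact ENNReal.ofReal_ne_top)]
    exact mul_le_mul_right (setLIntegral_mono' measurableSet_ball hAp) _
  refine (setLIntegral_mono' measurableSet_ball hpt).trans ?_
  have hfin : V ^ (p - 1) * (2 ^ p * K) ≠ ⊤ := by
    have : V ^ (p - 1) ≠ ⊤ := ENNReal.rpow_ne_top_of_nonneg (by linarith) hV
    finiteness
  rw [lintegral_const_mul' _ _ hVp, lintegral_const_mul' _ _ hfin, mul_assoc (V ^ p)⁻¹,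
    mul_assoc _ C]
  gcongr
  refine (hseg H hHm).trans_eq ?_
  congr 1
  refine setLIntegral_congr_fun measurableSet_ball fun x hx => ?_
  have hx1 : 0 < 1 - ‖x‖ := by rw [mem_ball_zero_iff] at hx; linarith
  simp only [hH, sphereWeight]
  rw [mul_assoc, ← ENNReal.ofReal_mul (by positivity), ← Real.rpow_add hx1, hγ]
  congr 3
  ring

end Poincare

section PartialDerivatives

variable {n : ℕ} {U : Set (EuclideanSpace ℝ (Fin n))} {f g : EuclideanSpace ℝ (Fin n) → ℝ}

lemma ContDiffOn.pdF (hU : IsOpen U) (hf : ContDiffOn ℝ (⊤ : ℕ∞) f U) (i : Fin n) :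
    ContDiffOn ℝ (⊤ : ℕ∞) (pdF i f) U :=
  (hf.fderiv_of_isOpen hU (m := (⊤ : ℕ∞)) (by simp)).clm_apply contDiffOn_const

lemma Set.EqOn.pdF (hU : IsOpen U) (h : Set.EqOn f g U) (i : Fin n) :
    Set.EqOn (pdF i f) (pdF i g) U := fun x hx => by
  have : f =ᶠ[nhds x] g := Filter.eventuallyEq_of_mem (hU.mem_nhds hx) h
  simp only [_root_.pdF, this.fderiv_eq]

lemma pdF_comm (hU : IsOpen U) (hf : ContDiffOn ℝ (⊤ : ℕ∞) f U) (i j : Fin n) :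
    Set.EqOn (pdF i (pdF j f)) (pdF j (pdF i f)) U := fun x hx => by
  have hfx : ContDiffAt ℝ (⊤ : ℕ∞) f x := hf.contDiffAt (hU.mem_nhds hx)
  have hd : DifferentiableAt ℝ (fderiv ℝ f) x :=
    (hfx.fderiv_right (m := 1) (by norm_cast)).differentiableAt one_ne_zero
  have hs : IsSymmSndFDerivAt ℝ f x :=
    hfx.isSymmSndFDerivAt (by
      rw [minSmoothness_of_isRCLikeNormedField]; exact WithTop.coe_le_coe.2 le_top)
  have h : ∀ k l : Fin n, pdF k (pdF l f) x =
      fderiv ℝ (fderiv ℝ f) x (EuclideanSpace.single k 1) (EuclideanSpace.single l 1) := by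
    intro k l
    change fderiv ℝ (fun z => fderiv ℝ f z (EuclideanSpace.single l 1)) x _ = _
    rw [fderiv_clm_apply hd (differentiableAt_const _)]
    simp
  rw [h, h, hs.eq]

lemma ContDiffOn.iterate_pdF (hU : IsOpen U) (hf : ContDiffOn ℝ (⊤ : ℕ∞) f U) (i : Fin n) (m : ℕ) :
    ContDiffOn ℝ (⊤ : ℕ∞) ((_root_.pdF i)^[m] f) U := by
  induction m generalizing f with
  | zero => exact hf
  | succ m ih => exact ih (hf.pdF hU i)

lemma Set.EqOn.iterate_pdF (hU : IsOpen U) (h : Set.EqOn f g U) (i : Fin n) (m : ℕ) :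
    Set.EqOn ((_root_.pdF i)^[m] f) ((_root_.pdF i)^[m] g) U := by
  induction m generalizing f g with
  | zero => exact h
  | succ m ih => exact ih (h.pdF hU i)

lemma iterate_pdF_comm (hU : IsOpen U) (hf : ContDiffOn ℝ (⊤ : ℕ∞) f U) (i j : Fin n) (m : ℕ) :
    Set.EqOn ((pdF i)^[m] (pdF j f)) (pdF j ((pdF i)^[m] f)) U := by
  induction m generalizing f with
  | zero => exact fun _ _ => rfl
  | succ m ih => exact ((pdF_comm hU hf i j).iterate_pdF hU i m).trans (ih (hf.pdF hU i))

variable (κ : Fin n → ℕ) (l : List (Fin n))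

lemma ContDiffOn.foldl_pdF (hU : IsOpen U) (hf : ContDiffOn ℝ (⊤ : ℕ∞) f U) :
    ContDiffOn ℝ (⊤ : ℕ∞) (l.foldl (fun g i => (_root_.pdF i)^[κ i] g) f) U := by
  induction l generalizing f with
  | nil => exact hf
  | cons a l ih => exact ih (hf.iterate_pdF hU a (κ a))

lemma Set.EqOn.foldl_pdF (hU : IsOpen U) (h : Set.EqOn f g U) :
    Set.EqOn (l.foldl (fun g i => (_root_.pdF i)^[κ i] g) f)
      (l.foldl (fun g i => (_root_.pdF i)^[κ i] g) g) U := by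
  induction l generalizing f g with
  | nil => exact h
  | cons a l ih => exact ih (h.iterate_pdF hU a (κ a))

lemma foldl_pdF_comm (hU : IsOpen U) (hf : ContDiffOn ℝ (⊤ : ℕ∞) f U) (j : Fin n) :
    Set.EqOn (l.foldl (fun g i => (pdF i)^[κ i] g) (pdF j f))
      (pdF j (l.foldl (fun g i => (pdF i)^[κ i] g) f)) U := by
  induction l generalizing f with
  | nil => exact fun _ _ => rfl
  | cons a l ih =>
    exact ((iterate_pdF_comm hU hf a j (κ a)).foldl_pdF κ l hU).trans
      (ih (hf.iterate_pdF hU a (κ a)))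

lemma foldl_pdF_add_single (hU : IsOpen U) (hf : ContDiffOn ℝ (⊤ : ℕ∞) f U) (j : Fin n)
    (hl : l.Nodup) (hj : j ∈ l) :
    Set.EqOn (l.foldl (fun g i => (pdF i)^[(κ + Pi.single j 1 : Fin n → ℕ) i] g) f)
      (pdF j (l.foldl (fun g i => (pdF i)^[κ i] g) f)) U := by
  induction l generalizing f with
  | nil => simp at hj
  | cons a l ih =>
    rw [List.nodup_cons] at hl
    by_cases haj : a = j
    · subst haj
      have h : ∀ f, l.foldl (fun g i => (pdF i)^[(κ + Pi.single a 1 : Fin n → ℕ) i] g) f =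
          l.foldl (fun g i => (pdF i)^[κ i] g) f := by
        intro f
        refine List.foldl_ext _ _ _ fun g i hi => ?_
        have : i ≠ a := fun h => hl.1 (h ▸ hi)
        simp [this]
      rw [List.foldl_cons, List.foldl_cons, h]
      simp only [Pi.add_apply, Pi.single_eq_same, Function.iterate_succ_apply']
      exact foldl_pdF_comm κ l hU (hf.iterate_pdF hU a (κ a)) a
    · have hjl : j ∈ l := (List.mem_cons.1 hj).resolve_left (Ne.symm haj)
      have : (κ + Pi.single j 1 : Fin n → ℕ) a = κ a := by simp [haj]
      simp only [List.foldl_cons, this]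
      exact ih (hf.iterate_pdF hU a (κ a)) hl.2 hjl

lemma mderivF_zero (f : EuclideanSpace ℝ (Fin n) → ℝ) : mderivF 0 f = f :=
  List.foldl_fixed _

lemma mderivF_add_single (hU : IsOpen U) (hf : ContDiffOn ℝ (⊤ : ℕ∞) f U) (j : Fin n) :
    Set.EqOn (mderivF (κ + Pi.single j 1) f) (pdF j (mderivF κ f)) U :=
  foldl_pdF_add_single κ _ hU hf j (List.nodup_finRange n) (List.mem_finRange j)

end PartialDerivatives

section EuclideanPoincare

variable {n : ℕ} {p : ℝ}

lemma enorm_fderiv_rpow_le (hp : 1 ≤ p) (g : EuclideanSpace ℝ (Fin n) → ℝ)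
    (x : EuclideanSpace ℝ (Fin n)) :
    ‖fderiv ℝ g x‖ₑ ^ p ≤ (n : ENNReal) ^ (p - 1) * ∑ i, ‖pdF i g x‖ₑ ^ p := by
  have h : ‖fderiv ℝ g x‖ ≤ ∑ i, ‖pdF i g x‖ := by
    refine ContinuousLinearMap.opNorm_le_bound _ (by positivity) fun v => ?_
    have hv : v = ∑ i, v i • EuclideanSpace.single i (1 : ℝ) := by
      conv_lhs => rw [← (EuclideanSpace.basisFun (Fin n) ℝ).sum_repr v]
      simp
    conv_lhs => rw [hv, map_sum]
    refine (norm_sum_le _ _).trans ?_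
    rw [Finset.sum_mul]
    refine Finset.sum_le_sum fun i _ => ?_
    rw [map_smul, norm_smul, mul_comm]
    exact mul_le_mul_of_nonneg_left (PiLp.norm_apply_le v i) (norm_nonneg _)
  have h' : ‖fderiv ℝ g x‖ₑ ≤ ∑ i, ‖pdF i g x‖ₑ := by
    simp only [← ofReal_norm]
    rw [← ENNReal.ofReal_sum_of_nonneg fun _ _ => norm_nonneg _]
    exact ENNReal.ofReal_le_ofReal h
  refine (ENNReal.rpow_le_rpow h' (by linarith)).trans ?_
  simpa using ENNReal.rpow_sum_le_const_mul_sum_rpow Finset.univ (fun i => ‖pdF i g x‖ₑ) hp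

lemma exists_weighted_poincare_pdF {α : ℝ} (hα : -1 < α) (hp : 1 ≤ p) :
    ∃ C : ENNReal, C < ⊤ ∧ ∀ g : EuclideanSpace ℝ (Fin n) → ℝ,
      ContDiffOn ℝ (⊤ : ℕ∞) g (ball 0 1) →
      ∫ y in ball (0 : EuclideanSpace ℝ (Fin n)) (1 / 2), g y = 0 →
      ∫⁻ x in ball (0 : EuclideanSpace ℝ (Fin n)) 1, ‖g x‖ₑ ^ p * sphereWeight α x ≤
        C * ∑ i, ∫⁻ x in ball (0 : EuclideanSpace ℝ (Fin n)) 1,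
          ‖pdF i g x‖ₑ ^ p * sphereWeight (α + p) x := by
  obtain ⟨C, hC, h⟩ := exists_weighted_poincare
    (volume : Measure (EuclideanSpace ℝ (Fin n))) hα hp
  have hn : (n : ENNReal) ^ (p - 1) ≠ ⊤ :=
    ENNReal.rpow_ne_top_of_nonneg (by linarith) (ENNReal.natCast_ne_top n)
  refine ⟨C * (n : ENNReal) ^ (p - 1), by finiteness, fun g hg h0 => ?_⟩
  refine (h g (hg.of_le (by exact_mod_cast le_top)) h0).trans ?_
  rw [mul_assoc, ← lintegral_finsetSum, ← lintegral_const_mul' _ _ hn]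
  · refine mul_le_mul_right (lintegral_mono fun x => ?_) C
    refine (mul_le_mul_left (enorm_fderiv_rpow_le hp g x) _).trans_eq ?_
    rw [mul_assoc, Finset.sum_mul]
  · intro i _
    exact ((measurable_fderiv_apply_const ℝ g _).enorm.pow_const p).mul (measurable_sphereWeight _)

lemma exists_weighted_poincare_mderivF (hp : 1 ≤ p) {α : ℝ} (hα : -1 < α) (k : ℕ) :
    ∃ C : ENNReal, C < ⊤ ∧ ∀ f : EuclideanSpace ℝ (Fin n) → ℝ,
      ContDiffOn ℝ (⊤ : ℕ∞) f (ball 0 1) →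
      (∀ κ : Fin n → ℕ, ∑ i, κ i < k →
        ∫ y in ball (0 : EuclideanSpace ℝ (Fin n)) (1 / 2), mderivF κ f y = 0) →
      ∫⁻ x in ball (0 : EuclideanSpace ℝ (Fin n)) 1, ‖f x‖ₑ ^ p * sphereWeight α x ≤
        C * ∑ κ ∈ Finset.Nat.antidiagonalTuple n k,
          ∫⁻ x in ball (0 : EuclideanSpace ℝ (Fin n)) 1,
            ‖mderivF κ f x‖ₑ ^ p * sphereWeight (α + p * k) x := by
  induction k with
  | zero =>
    refine ⟨1, by simp, fun f _ _ => ?_⟩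
    simp [Finset.Nat.antidiagonalTuple_zero_right, mderivF_zero]
  | succ k ih =>
    obtain ⟨C, hC, hk⟩ := ih
    have hβ : -1 < α + p * k := by
      have : 0 ≤ p * k := mul_nonneg (by linarith) (Nat.cast_nonneg k)
      linarith
    obtain ⟨D, hD, h1⟩ := exists_weighted_poincare_pdF (n := n) hβ hp
    set T := Finset.Nat.antidiagonalTuple n k
    refine ⟨C * (T.card * (D * n)), by finiteness, fun f hf h0 => ?_⟩
    refine (hk f hf fun κ hκ => h0 κ (by omega)).trans ?_
    rw [mul_assoc]
    refine mul_le_mul_right ?_ C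
    rw [mul_assoc, ← nsmul_eq_mul]
    refine Finset.sum_le_card_nsmul _ _ _ fun κ hκ => ?_
    rw [Finset.Nat.mem_antidiagonalTuple] at hκ
    refine (h1 _ (hf.foldl_pdF κ _ isOpen_ball) (h0 κ (by omega))).trans ?_
    rw [mul_assoc]
    refine mul_le_mul_right ?_ D
    have hcard : (n : ENNReal) = (Finset.univ : Finset (Fin n)).card := by simp
    rw [hcard, ← nsmul_eq_mul]
    refine Finset.sum_le_card_nsmul _ _ _ fun i _ => ?_
    have hmem : κ + Pi.single i 1 ∈ Finset.Nat.antidiagonalTuple n (k + 1) := by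
      rw [Finset.Nat.mem_antidiagonalTuple]
      simp [Finset.sum_add_distrib, hκ]
    refine le_trans (le_of_eq ?_) (Finset.single_le_sum (f := fun κ =>
      ∫⁻ x in ball (0 : EuclideanSpace ℝ (Fin n)) 1,
        ‖mderivF κ f x‖ₑ ^ p * sphereWeight (α + p * (k + 1 : ℕ)) x) (fun _ _ => zero_le) hmem)
    refine setLIntegral_congr_fun measurableSet_ball fun x hx => ?_
    rw [mderivF_add_single κ isOpen_ball hf i hx]
    congr 2
    push_cast
    ring

lemma ofReal_abs_rpow_mul_le {x : EuclideanSpace ℝ (Fin n)} (hx : x ∈ ball 0 1) (hp : 1 ≤ p)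
    (α a : ℝ) :
    ENNReal.ofReal (|a| ^ p * (1 - ‖x‖ ^ 2) ^ α) ≤
      ENNReal.ofReal (2 ^ |α|) * (‖a‖ₑ ^ p * sphereWeight α x) := by
  rw [mem_ball_zero_iff] at hx
  have hd : 0 < 1 - ‖x‖ := by linarith
  have h1 : (1 - ‖x‖ ^ 2) ^ α ≤ 2 ^ |α| * (1 - ‖x‖) ^ α := by
    rw [show 1 - ‖x‖ ^ 2 = (1 + ‖x‖) * (1 - ‖x‖) by ring, Real.mul_rpow (by positivity) hd.le]
    gcongr
    calc (1 + ‖x‖) ^ α ≤ (1 + ‖x‖) ^ |α| :=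
          Real.rpow_le_rpow_of_exponent_le (by linarith [norm_nonneg x]) (le_abs_self α)
      _ ≤ 2 ^ |α| := Real.rpow_le_rpow (by positivity) (by linarith) (abs_nonneg α)
  rw [← Real.enorm_abs, Real.enorm_of_nonneg (abs_nonneg a),
    ENNReal.ofReal_rpow_of_nonneg (abs_nonneg a) (by linarith), sphereWeight,
    ← ENNReal.ofReal_mul (by positivity), ← ENNReal.ofReal_mul (by positivity)]
  refine ENNReal.ofReal_le_ofReal ?_
  rw [mul_left_comm]
  gcongr

lemma enorm_rpow_mul_sphereWeight_le {x : EuclideanSpace ℝ (Fin n)} (hx : x ∈ ball 0 1)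
    (hp : 1 ≤ p) {β : ℝ} (hβ : 0 ≤ β) (a : ℝ) :
    ‖a‖ₑ ^ p * sphereWeight β x ≤ ENNReal.ofReal (|a| ^ p * (1 - ‖x‖ ^ 2) ^ β) := by
  rw [mem_ball_zero_iff] at hx
  rw [← Real.enorm_abs, Real.enorm_of_nonneg (abs_nonneg a),
    ENNReal.ofReal_rpow_of_nonneg (abs_nonneg a) (by linarith), sphereWeight,
    ← ENNReal.ofReal_mul (by positivity)]
  refine ENNReal.ofReal_le_ofReal ?_
  have hd : 0 ≤ 1 - ‖x‖ := by linarith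
  gcongr
  nlinarith [norm_nonneg x]

end EuclideanPoincare

theorem stmt_17 {n : ℕ} (hn : 2 ≤ n) (α p : ℝ) (k : ℕ) (hα : -1 < α)
    (hp : 1 ≤ p) (hk : 1 ≤ k) :
    ∃ C > 0, ∀ f : EuclideanSpace ℝ (Fin n) → ℝ,
      ContDiffOn ℝ (⊤ : ℕ∞) f (ball 0 1) →
      (∀ κ : Fin n → ℕ, (∑ i, κ i) ≤ k - 1 →
        (∫ x in ball (0 : EuclideanSpace ℝ (Fin n)) (1 / 2), mderivF κ f x) = 0) →
      (∫⁻ x in ball (0 : EuclideanSpace ℝ (Fin n)) 1,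
          ENNReal.ofReal (|f x| ^ p * (1 - ‖x‖ ^ 2) ^ α))
        ≤ ENNReal.ofReal C *
          ∑ κ ∈ Finset.Nat.antidiagonalTuple n k,
            ∫⁻ x in ball (0 : EuclideanSpace ℝ (Fin n)) 1,
              ENNReal.ofReal (|mderivF κ f x| ^ p * (1 - ‖x‖ ^ 2) ^ (α + p * k)) := by
  obtain ⟨C, hC, h⟩ := exists_weighted_poincare_mderivF (n := n) hp hα k
  have hβ : 0 ≤ α + p * k := by
    have : (1 : ℝ) ≤ k := by exact_mod_cast hk
    nlinarith
  refine ⟨2 ^ |α| * C.toReal + 1, by positivity, fun f hf h0 => ?_⟩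
  calc _ ≤ ∫⁻ x in ball (0 : EuclideanSpace ℝ (Fin n)) 1,
          ENNReal.ofReal (2 ^ |α|) * (‖f x‖ₑ ^ p * sphereWeight α x) :=
        setLIntegral_mono' measurableSet_ball fun x hx => ofReal_abs_rpow_mul_le hx hp α (f x)
    _ ≤ ENNReal.ofReal (2 ^ |α|) * (C * ∑ κ ∈ Finset.Nat.antidiagonalTuple n k,
          ∫⁻ x in ball (0 : EuclideanSpace ℝ (Fin n)) 1,
            ‖mderivF κ f x‖ₑ ^ p * sphereWeight (α + p * k) x) := by
        rw [lintegral_const_mul' _ _ ENNReal.ofReal_ne_top]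
        gcongr
        exact h f hf fun κ hκ => h0 κ (by omega)
    _ ≤ _ := by
        rw [← mul_assoc]
        refine mul_le_mul' ?_ (Finset.sum_le_sum fun κ _ => setLIntegral_mono' measurableSet_ball
          fun x hx => enorm_rpow_mul_sphereWeight_le hx hp hβ _)
        rw [← ENNReal.ofReal_toReal hC.ne, ← ENNReal.ofReal_mul (by positivity),
          ENNReal.toReal_ofReal ENNReal.toReal_nonneg]
        exact ENNReal.ofReal_le_ofReal (by linarith)
end

section
/- Let k ≥ 1 and n ≥ 2. There exists a constant C = C(n,k) such that for all multi-indices κ with |κ| = k, all m ≥ k, and all x, y in the open unit ball of ℝⁿ, |∂^κ_x Z_m(x,y)| ≤ C m^{n-2+k} |x|^{m-k} |y|^m, where Z_m is the zonal harmonic of degree m (the reproducing kernel of degree-m spherical harmonics, extended by homogeneity of degree m in each variable). -/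
open MeasureTheory MvPolynomial

/-- The polynomial Laplacian `Δp = Σᵢ ∂²p/∂xᵢ²`. -/
noncomputable def mpLap {n : ℕ} (p : MvPolynomial (Fin n) ℝ) : MvPolynomial (Fin n) ℝ :=
  ∑ i : Fin n, pderiv i (pderiv i p)

/-- Iterated partial derivative `∂^κ p` of a polynomial, multi-index `κ`. -/
noncomputable def mpDeriv {n : ℕ} (κ : Fin n → ℕ) (p : MvPolynomial (Fin n) ℝ) :
    MvPolynomial (Fin n) ℝ :=
  (List.finRange n).foldl (fun q i => (fun r => pderiv i r)^[κ i] q) p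

/-- Evaluation of a polynomial at a point of `ℝⁿ`. -/
noncomputable def evP {n : ℕ} (p : MvPolynomial (Fin n) ℝ)
    (x : EuclideanSpace ℝ (Fin n)) : ℝ :=
  eval (fun i => x i) p

/-- The normalized surface measure on the unit sphere of `ℝⁿ`. -/
noncomputable def sphMeasure (n : ℕ) :
    Measure (Metric.sphere (0 : EuclideanSpace ℝ (Fin n)) 1) :=
  (((volume : Measure (EuclideanSpace ℝ (Fin n))).toSphere Set.univ)⁻¹) •
    (volume : Measure (EuclideanSpace ℝ (Fin n))).toSphere

/-- `Z m y` is the zonal harmonic of degree `m` with pole `y`, viewed as a polynomial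
in the first variable: it is harmonic and homogeneous of degree `m` in each variable,
symmetric, and for poles on the sphere it reproduces degree-`m` spherical harmonics. -/
structure IsZonalHarmonic (n : ℕ)
    (Z : ℕ → EuclideanSpace ℝ (Fin n) → MvPolynomial (Fin n) ℝ) : Prop where
  harm : ∀ m y, mpLap (Z m y) = 0
  hom : ∀ m y, (Z m y).IsHomogeneous m
  symm : ∀ m x y, evP (Z m y) x = evP (Z m x) y
  scale : ∀ m (c : ℝ), 0 ≤ c → ∀ y x, evP (Z m (c • y)) x = c ^ m * evP (Z m y) x
  repro : ∀ m (p : MvPolynomial (Fin n) ℝ), mpLap p = 0 → p.IsHomogeneous m →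
    ∀ η : Metric.sphere (0 : EuclideanSpace ℝ (Fin n)) 1,
      (∫ ζ : Metric.sphere (0 : EuclideanSpace ℝ (Fin n)) 1,
        evP p ζ * evP (Z m (η : EuclideanSpace ℝ (Fin n))) ζ ∂(sphMeasure n)) = evP p η

/-- The normalized surface measure is a probability measure. -/
theorem isProbabilityMeasure_sphMeasure {n : ℕ} (hn : 1 ≤ n) :
    IsProbabilityMeasure (sphMeasure n) := by
  have : Nonempty (Fin n) := ⟨⟨0, hn⟩⟩
  have h : (volume : Measure (EuclideanSpace ℝ (Fin n))).toSphere ≠ 0 :=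
    Measure.toSphere_ne_zero _
  have : NeZero (volume : Measure (EuclideanSpace ℝ (Fin n))).toSphere := ⟨h⟩
  exact isProbabilityMeasureSMul

/-- The map induced on the unit sphere by a linear isometry. -/
noncomputable def sphMap {n : ℕ} (T : EuclideanSpace ℝ (Fin n) ≃ₗᵢ[ℝ] EuclideanSpace ℝ (Fin n))
    (ζ : Metric.sphere (0 : EuclideanSpace ℝ (Fin n)) 1) :
    Metric.sphere (0 : EuclideanSpace ℝ (Fin n)) 1 :=
  ⟨T ζ, by simp⟩

theorem continuous_sphMap {n : ℕ}
    (T : EuclideanSpace ℝ (Fin n) ≃ₗᵢ[ℝ] EuclideanSpace ℝ (Fin n)) :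
    Continuous (sphMap T) :=
  (T.continuous.comp continuous_subtype_val).subtype_mk _

open scoped Pointwise in
/-- The normalized surface measure is invariant under linear isometries. -/
theorem measurePreserving_sphMap {n : ℕ}
    (T : EuclideanSpace ℝ (Fin n) ≃ₗᵢ[ℝ] EuclideanSpace ℝ (Fin n)) :
    MeasurePreserving (sphMap T) (sphMeasure n) (sphMeasure n) := by
  have hm : Measurable (sphMap T) := (continuous_sphMap T).measurable
  refine MeasurePreserving.smul_measure ⟨hm, ?_⟩ _
  ext s hs
  rw [Measure.map_apply hm hs, Measure.toSphere_apply' _ hs,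
    Measure.toSphere_apply' _ (hm hs)]
  congr 1
  have : Set.Ioo (0 : ℝ) 1 • ((↑) '' (sphMap T ⁻¹' s) : Set (EuclideanSpace ℝ (Fin n)))
      = T ⁻¹' (Set.Ioo (0 : ℝ) 1 • ((↑) '' s)) := by
    ext x
    simp only [Set.mem_smul, Set.mem_image, Set.mem_preimage]
    constructor
    · rintro ⟨r, hr, _, ⟨ζ, hζ, rfl⟩, rfl⟩
      exact ⟨r, hr, _, ⟨_, hζ, rfl⟩, by simp [sphMap]⟩
    · rintro ⟨r, hr, _, ⟨ζ, hζ, rfl⟩, h⟩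
      refine ⟨r, hr, _, ⟨sphMap T.symm ζ, ?_, rfl⟩, ?_⟩
      · have : sphMap T (sphMap T.symm ζ) = ζ := Subtype.ext (by simp [sphMap])
        rwa [this]
      · apply T.injective
        simp [sphMap, h]
  rw [this]
  exact T.measurePreserving.measure_preimage_equiv (f := T.toHomeomorph.toMeasurableEquiv) _

theorem continuous_evP {n : ℕ} (p : MvPolynomial (Fin n) ℝ) : Continuous (evP p) := by
  unfold evP
  exact (MvPolynomial.continuous_eval p).comp (by fun_prop)

theorem integrable_sphMeasure {n : ℕ}
    {f : Metric.sphere (0 : EuclideanSpace ℝ (Fin n)) 1 → ℝ} (hf : Continuous f) :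
    Integrable f (sphMeasure n) := by
  have h : Integrable f (volume : Measure (EuclideanSpace ℝ (Fin n))).toSphere :=
    hf.integrable_of_hasCompactSupport (HasCompactSupport.of_compactSpace f)
  by_cases h0 : (volume : Measure (EuclideanSpace ℝ (Fin n))).toSphere = 0
  · simp [sphMeasure, h0]
  · exact h.smul_measure (ENNReal.inv_ne_top.2 (Measure.measure_univ_ne_zero.2 h0))

theorem continuous_evP_mul_evP {n : ℕ} (p q : MvPolynomial (Fin n) ℝ) :
    Continuous fun ζ : Metric.sphere (0 : EuclideanSpace ℝ (Fin n)) 1 => evP p ζ * evP q ζ :=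
  ((continuous_evP p).comp continuous_subtype_val).mul
    ((continuous_evP q).comp continuous_subtype_val)

/-- Homogeneous polynomials scale by a power of the scalar under any substitution. -/
theorem aeval_mul_of_isHomogeneous {A : Type*} [CommRing A] [Algebra ℝ A] {n d : ℕ}
    {p : MvPolynomial (Fin n) ℝ} (hp : p.IsHomogeneous d) (c : A) (x : Fin n → A) :
    aeval (fun i => c * x i) p = c ^ d * aeval x p := by
  rw [aeval_def, aeval_def, eval₂_eq', eval₂_eq', Finset.mul_sum]
  refine Finset.sum_congr rfl fun s hs => ?_
  have h : ∑ i, s i = d := by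
    rw [← Finsupp.degree_eq_sum, Finsupp.degree_eq_weight_one]
    exact hp (mem_support_iff.1 hs)
  simp_rw [mul_pow, Finset.prod_mul_distrib, Finset.prod_pow_eq_pow_sum, h]
  ring

theorem evP_smul {n d : ℕ} {p : MvPolynomial (Fin n) ℝ} (hp : p.IsHomogeneous d) (c : ℝ)
    (x : EuclideanSpace ℝ (Fin n)) : evP p (c • x) = c ^ d * evP p x :=
  aeval_mul_of_isHomogeneous hp c fun i => x i

/-- Chain rule for the partial derivatives of a substitution into a polynomial. -/
theorem pderiv_aeval {n : ℕ} (g : Fin n → MvPolynomial (Fin n) ℝ) (i : Fin n)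
    (p : MvPolynomial (Fin n) ℝ) :
    pderiv i (aeval g p) = ∑ j, aeval g (pderiv j p) * pderiv i (g j) := by
  induction p using MvPolynomial.induction_on with
  | C a => simp [algebraMap_eq]
  | add p q hp hq => simp only [map_add, hp, hq, add_mul, Finset.sum_add_distrib]
  | mul_X p j hp =>
    simp only [map_mul, aeval_X, pderiv_mul, hp, map_add, add_mul, Finset.sum_add_distrib,
      Finset.sum_mul, pderiv_X]
    congr 1
    · exact Finset.sum_congr rfl fun k _ => by ring
    · simp [Pi.single_apply, Finset.sum_ite_eq]

/-- Chain rule for a polynomial along a complex curve. -/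
theorem hasDerivAt_aeval {n : ℕ} {c : Fin n → ℂ → ℂ} {c' : Fin n → ℂ} {z : ℂ}
    (hc : ∀ j, HasDerivAt (c j) (c' j) z) (p : MvPolynomial (Fin n) ℝ) :
    HasDerivAt (fun w => aeval (fun j => c j w) p)
      (∑ j, aeval (fun j => c j z) (pderiv j p) * c' j) z := by
  induction p using MvPolynomial.induction_on with
  | C a => simpa using hasDerivAt_const z _
  | add p q hp hq =>
    simp only [map_add, add_mul, Finset.sum_add_distrib]
    exact hp.fun_add hq
  | mul_X p j hp =>
    simp only [map_mul, aeval_X]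
    refine (hp.fun_mul (hc j)).congr_deriv ?_
    simp only [pderiv_mul, map_add, map_mul, aeval_X, add_mul, Finset.sum_add_distrib,
      Finset.sum_mul, pderiv_X]
    congr 1
    · exact Finset.sum_congr rfl fun k _ => by ring
    · simp [Pi.single_apply]

/-- The complexification of a great circle arc, multiplied by `z`: for `z = exp (i t)` it is
`z • (cos t • x + sin t • v)`. -/
noncomputable def circleCurve {n : ℕ} (x v : Fin n → ℝ) (j : Fin n) (z : ℂ) : ℂ :=
  (z ^ 2 + 1) / 2 * x j + (z ^ 2 - 1) / (2 * Complex.I) * v j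

theorem norm_aeval_circleCurve_of_norm_eq_one {n d : ℕ} {p : MvPolynomial (Fin n) ℝ}
    (hp : p.IsHomogeneous d) {M : ℝ} {x v : EuclideanSpace ℝ (Fin n)}
    (hM : ∀ y : EuclideanSpace ℝ (Fin n), ‖y‖ ≤ 1 → |evP p y| ≤ M)
    (hx : ‖x‖ = 1) (hv : ‖v‖ ≤ 1) (hxv : inner ℝ x v = 0) {z : ℂ} (hz : ‖z‖ = 1) :
    ‖aeval (fun j => circleCurve (fun i => x i) (fun i => v i) j z) p‖ ≤ M := by
  obtain ⟨t, rfl⟩ : ∃ t : ℝ, z = Complex.exp (t * Complex.I) :=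
    ⟨z.arg, by simpa [hz] using (Complex.norm_mul_exp_arg_mul_I z).symm⟩
  set y : EuclideanSpace ℝ (Fin n) := Real.cos t • x + Real.sin t • v with hy
  have hy1 : ‖y‖ ≤ 1 := by
    have h : ‖y‖ ^ 2 = Real.cos t ^ 2 * ‖x‖ ^ 2 + Real.sin t ^ 2 * ‖v‖ ^ 2 := by
      rw [hy, norm_add_sq_real, real_inner_smul_left, real_inner_smul_right, hxv, norm_smul,
        norm_smul, mul_pow, mul_pow, Real.norm_eq_abs, Real.norm_eq_abs, sq_abs, sq_abs]
      ring
    have h2 : ‖v‖ ^ 2 ≤ 1 := pow_le_one₀ (norm_nonneg _) hv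
    refine (sq_le_one_iff₀ (norm_nonneg _)).1 ?_
    rw [h, hx]
    nlinarith [Real.sin_sq_add_cos_sq t, sq_nonneg (Real.sin t)]
  have hc : (fun j => circleCurve (fun i => x i) (fun i => v i) j (Complex.exp (t * Complex.I)))
      = fun j => Complex.exp (t * Complex.I) * ((y j : ℝ) : ℂ) := by
    funext j
    have he : Complex.exp (t * Complex.I) * Complex.exp (-(t * Complex.I)) = 1 := by
      rw [← Complex.exp_add]; simp
    simp only [circleCurve, hy, PiLp.add_apply, PiLp.smul_apply, smul_eq_mul, Complex.ofReal_add,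
      Complex.ofReal_mul, Complex.ofReal_cos, Complex.ofReal_sin, Complex.cos, Complex.sin,
      neg_mul]
    generalize Complex.exp (t * Complex.I) = w, Complex.exp (-(t * Complex.I)) = w' at he
    field_simp
    ring_nf
    simp only [Complex.I_sq]
    linear_combination (v j - x j * Complex.I : ℂ) * he
  rw [hc, aeval_mul_of_isHomogeneous hp, norm_mul, norm_pow, hz, one_pow, one_mul]
  have : aeval (fun j => ((y j : ℝ) : ℂ)) p = ((evP p y : ℝ) : ℂ) :=
    aeval_algebraMap_apply ℂ (fun j => y j) p
  rw [this, Complex.norm_real]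
  exact hM y hy1

theorem differentiable_aeval_circleCurve {n : ℕ} (p : MvPolynomial (Fin n) ℝ) (x v : Fin n → ℝ) :
    Differentiable ℂ fun z => aeval (fun j => circleCurve x v j z) p := by
  intro z
  refine (hasDerivAt_aeval (c' := fun j => deriv (circleCurve x v j) z)
    (fun j => DifferentiableAt.hasDerivAt ?_) p).differentiableAt
  unfold circleCurve
  fun_prop

theorem norm_aeval_circleCurve_of_norm_le_one {n d : ℕ} {p : MvPolynomial (Fin n) ℝ}
    (hp : p.IsHomogeneous d) {M : ℝ} {x v : EuclideanSpace ℝ (Fin n)}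
    (hM : ∀ y : EuclideanSpace ℝ (Fin n), ‖y‖ ≤ 1 → |evP p y| ≤ M)
    (hx : ‖x‖ = 1) (hv : ‖v‖ ≤ 1) (hxv : inner ℝ x v = 0) {z : ℂ} (hz : ‖z‖ ≤ 1) :
    ‖aeval (fun j => circleCurve (fun i => x i) (fun i => v i) j z) p‖ ≤ M := by
  refine Complex.norm_le_of_forall_mem_frontier_norm_le (U := Metric.ball (0 : ℂ) 1)
    Metric.isBounded_ball (differentiable_aeval_circleCurve p _ _).diffContOnCl (fun w hw => ?_)
    (by rw [closure_ball _ one_ne_zero]; simpa using hz)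
  rw [frontier_ball _ one_ne_zero] at hw
  exact norm_aeval_circleCurve_of_norm_eq_one hp hM hx hv hxv (by simpa using hw)

/-- Bernstein-Walsh growth bound outside the unit disc. -/
theorem norm_aeval_circleCurve_le {n d : ℕ} {p : MvPolynomial (Fin n) ℝ}
    (hp : p.IsHomogeneous d) {M : ℝ} {x v : EuclideanSpace ℝ (Fin n)}
    (hM : ∀ y : EuclideanSpace ℝ (Fin n), ‖y‖ ≤ 1 → |evP p y| ≤ M)
    (hx : ‖x‖ = 1) (hv : ‖v‖ ≤ 1) (hxv : inner ℝ x v = 0) {z : ℂ} {R : ℝ} (hR : 1 ≤ R)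
    (hz : ‖z‖ ≤ R) :
    ‖aeval (fun j => circleCurve (fun i => x i) (fun i => v i) j z) p‖ ≤ R ^ (2 * d) * M := by
  have hM0 : 0 ≤ M := (abs_nonneg _).trans (hM 0 (by simp))
  rcases le_total ‖z‖ 1 with h | h
  · exact (norm_aeval_circleCurve_of_norm_le_one hp hM hx hv hxv h).trans
      (le_mul_of_one_le_left hM0 (one_le_pow₀ hR))
  have hz0 : z ≠ 0 := by
    rintro rfl
    norm_num at h
  have hc : (fun j => circleCurve (fun i => x i) (fun i => v i) j z)
      = fun j => z ^ 2 * circleCurve (fun i => x i) (fun i => (-v) i) j z⁻¹ := by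
    funext j
    simp only [circleCurve, PiLp.neg_apply, Complex.ofReal_neg]
    field_simp
    ring
  rw [hc, aeval_mul_of_isHomogeneous hp, norm_mul, norm_pow, norm_pow, ← pow_mul]
  have := norm_aeval_circleCurve_of_norm_le_one hp hM hx (v := -v) (by simpa using hv)
    (by simpa using hxv) (z := z⁻¹) (by rw [norm_inv]; exact inv_le_one_of_one_le₀ h)
  gcongr

/-- A Bernstein-type inequality: the gradient of a homogeneous polynomial of degree `d` on the
unit sphere is at most of order `d` times its supremum. -/
theorem abs_evP_pderiv_le_of_norm_eq_one {n d : ℕ} {p : MvPolynomial (Fin n) ℝ}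
    (hp : p.IsHomogeneous d) (hd : 1 ≤ d) {M : ℝ}
    (hM : ∀ y : EuclideanSpace ℝ (Fin n), ‖y‖ ≤ 1 → |evP p y| ≤ M) (i : Fin n)
    {x : EuclideanSpace ℝ (Fin n)} (hx : ‖x‖ = 1) :
    |evP (pderiv i p) x| ≤ 2 * Real.exp 2 * d * M := by
  have hM0 : 0 ≤ M := (abs_nonneg _).trans (hM 0 (by simp))
  have hd0 : (0 : ℝ) < d := by exact_mod_cast hd
  set e : EuclideanSpace ℝ (Fin n) := EuclideanSpace.single i 1 with he
  set v : EuclideanSpace ℝ (Fin n) := e - x i • x with hv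
  have hxe : inner ℝ x e = x i := by simp [he, PiLp.inner_apply, PiLp.single_apply]
  have hxv : inner ℝ x v = 0 := by
    rw [hv, inner_sub_right, hxe, real_inner_smul_right, real_inner_self_eq_norm_sq, hx]
    ring
  have he1 : ‖e‖ = 1 := by simp [he]
  have hv1 : ‖v‖ ≤ 1 := by
    have h : ‖v‖ ^ 2 = 1 - x i ^ 2 := by
      rw [hv, norm_sub_sq_real, real_inner_smul_right, real_inner_comm, hxe, norm_smul, mul_pow,
        hx, he1, Real.norm_eq_abs, sq_abs]
      ring
    refine (sq_le_one_iff₀ (norm_nonneg _)).1 ?_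
    nlinarith [sq_nonneg (x i)]
  have hxi : |x i| ≤ 1 := by
    rw [← hx, ← Real.norm_eq_abs]
    exact PiLp.norm_apply_le x i
  set q : ℂ → ℂ := fun z => aeval (fun j => circleCurve (fun i => x i) (fun i => v i) j z) p
  have hbound : ‖deriv q 1‖ ≤ Real.exp 2 * M / (1 / d) := by
    refine Complex.norm_deriv_le_of_forall_mem_sphere_norm_le (by positivity)
      (differentiable_aeval_circleCurve p _ _).diffContOnCl fun z hz => ?_
    have hz' : ‖z‖ ≤ 1 + 1 / d := by
      have := norm_sub_norm_le z 1
      rw [mem_sphere_iff_norm] at hz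
      rw [hz, norm_one] at this
      linarith
    refine (norm_aeval_circleCurve_le hp hM hx hv1 hxv (by simp) hz').trans ?_
    gcongr
    calc (1 + 1 / (d : ℝ)) ^ (2 * d) ≤ Real.exp (1 / d) ^ (2 * d) := by
          gcongr
          linarith [Real.add_one_le_exp (1 / (d : ℝ))]
      _ = Real.exp 2 := by
          rw [← Real.exp_nat_mul]
          congr 1
          push_cast
          field_simp
  have hder : HasDerivAt q (∑ j, (evP (pderiv j p) x : ℂ) * (x j - Complex.I * v j)) 1 := by
    have hj : ∀ j, HasDerivAt (circleCurve (fun i => x i) (fun i => v i) j)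
        (x j - Complex.I * v j) 1 := by
      intro j
      have h2 : HasDerivAt (fun z : ℂ => z ^ 2) 2 1 := by
        simpa using hasDerivAt_pow 2 (1 : ℂ)
      refine ((((h2.add_const 1).div_const 2).mul_const (x j : ℂ)).add
        (((h2.sub_const 1).div_const (2 * Complex.I)).mul_const (v j : ℂ))).congr_deriv ?_
      field_simp
      ring_nf
      simp only [Complex.I_sq]
      ring
    refine (hasDerivAt_aeval hj p).congr_deriv (Finset.sum_congr rfl fun j _ => ?_)
    congr 1
    have : (fun j => circleCurve (fun i => x i) (fun i => v i) j 1) = fun j => ((x j : ℝ) : ℂ) := by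
      funext j
      simp [circleCurve]
    rw [this]
    exact aeval_algebraMap_apply ℂ (fun j => x j) _
  rw [hder.deriv] at hbound
  have hre := (Complex.abs_re_le_norm _).trans hbound
  have him := (Complex.abs_im_le_norm _).trans hbound
  simp only [Complex.re_sum, Complex.im_sum, Complex.sub_re, Complex.sub_im, Complex.ofReal_re,
    Complex.ofReal_im, Complex.mul_re, Complex.mul_im, Complex.I_re, Complex.I_im, zero_mul,
    one_mul, mul_zero, sub_zero, zero_sub, zero_add, mul_neg, Finset.sum_neg_distrib, abs_neg,
    add_zero, neg_zero] at hre him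
  have hdec : evP (pderiv i p) x = ∑ j, evP (pderiv j p) x * v j
      + x i * ∑ j, evP (pderiv j p) x * x j := by
    rw [Finset.mul_sum, ← Finset.sum_add_distrib]
    simp only [hv, he, PiLp.sub_apply, PiLp.smul_apply, smul_eq_mul, PiLp.single_apply]
    rw [Finset.sum_eq_single i]
    · simp
      ring
    · intro j _ hj
      simp [hj]
      ring
    · simp
  rw [hdec]
  generalize ∑ j, evP (pderiv j p) x * v j = a at him
  generalize ∑ j, evP (pderiv j p) x * x j = b at hre
  have hK : Real.exp 2 * M / (1 / d) = Real.exp 2 * d * M := by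
    field_simp
  rw [hK] at hre him
  have hb : |x i * b| ≤ 1 * |b| := by
    rw [abs_mul]
    exact mul_le_mul_of_nonneg_right hxi (abs_nonneg b)
  linarith [abs_add_le a (x i * b)]

theorem exists_unit_smul {n : ℕ} [NeZero n] (x : EuclideanSpace ℝ (Fin n)) :
    ∃ u : EuclideanSpace ℝ (Fin n), ‖u‖ = 1 ∧ x = ‖x‖ • u := by
  by_cases hx : x = 0
  · exact ⟨EuclideanSpace.single 0 1, by simp, by simp [hx]⟩
  · have : ‖x‖ ≠ 0 := norm_ne_zero_iff.2 hx
    exact ⟨‖x‖⁻¹ • x, by rw [norm_smul, norm_inv, norm_norm, inv_mul_cancel₀ this],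
      by rw [smul_smul, mul_inv_cancel₀ this, one_smul]⟩

/-- A Bernstein-type inequality for homogeneous polynomials on the whole space. -/
theorem abs_evP_pderiv_le {n d : ℕ} {p : MvPolynomial (Fin n) ℝ}
    (hp : p.IsHomogeneous d) {M : ℝ}
    (hM : ∀ y : EuclideanSpace ℝ (Fin n), |evP p y| ≤ M * ‖y‖ ^ d) (i : Fin n)
    (x : EuclideanSpace ℝ (Fin n)) :
    |evP (pderiv i p) x| ≤ 2 * Real.exp 2 * d * M * ‖x‖ ^ (d - 1) := by
  rcases Nat.eq_zero_or_pos d with rfl | hd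
  · obtain ⟨c, rfl⟩ : ∃ c, p = C c :=
      ⟨_, totalDegree_eq_zero_iff_eq_C.1 (Nat.le_zero.1 hp.totalDegree_le)⟩
    simp [evP]
  have hM0 : 0 ≤ M := by
    have := (abs_nonneg _).trans (hM (EuclideanSpace.single i 1))
    simpa using this
  have : NeZero n := ⟨i.pos.ne'⟩
  obtain ⟨u, hu, hxu⟩ := exists_unit_smul x
  have h := abs_evP_pderiv_le_of_norm_eq_one hp hd (M := M)
    (fun y hy => (hM y).trans (mul_le_of_le_one_right hM0 (pow_le_one₀ (norm_nonneg _) hy))) i hu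
  rw [hxu, evP_smul hp.pderiv, abs_mul, abs_pow, abs_norm, ← hxu, mul_comm]
  gcongr

theorem abs_evP_iterate_pderiv_le {n d m k : ℕ} (hdm : d ≤ m) {p : MvPolynomial (Fin n) ℝ}
    (hp : p.IsHomogeneous d) {M : ℝ}
    (hM : ∀ y : EuclideanSpace ℝ (Fin n), |evP p y| ≤ M * ‖y‖ ^ d) (i : Fin n) :
    ((fun r => pderiv i r)^[k] p).IsHomogeneous (d - k) ∧
      ∀ x : EuclideanSpace ℝ (Fin n), |evP ((fun r => pderiv i r)^[k] p) x| ≤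
        (2 * Real.exp 2 * m) ^ k * M * ‖x‖ ^ (d - k) := by
  have hM0 : 0 ≤ M := by
    have := (abs_nonneg _).trans (hM (EuclideanSpace.single i 1))
    simpa using this
  induction k with
  | zero => simpa using ⟨hp, hM⟩
  | succ k ih =>
    rw [Function.iterate_succ_apply', ← Nat.sub_sub]
    refine ⟨ih.1.pderiv, fun x => (abs_evP_pderiv_le ih.1 ih.2 i x).trans ?_⟩
    have hdk : ((d - k : ℕ) : ℝ) ≤ m := by exact_mod_cast (Nat.sub_le _ _).trans hdm
    calc _ ≤ 2 * Real.exp 2 * m * ((2 * Real.exp 2 * m) ^ k * M) * ‖x‖ ^ (d - k - 1) := by gcongr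
      _ = _ := by ring

theorem abs_evP_foldl_pderiv_le {n d m : ℕ} (hdm : d ≤ m) {p : MvPolynomial (Fin n) ℝ}
    (hp : p.IsHomogeneous d) {M : ℝ}
    (hM : ∀ y : EuclideanSpace ℝ (Fin n), |evP p y| ≤ M * ‖y‖ ^ d) (κ : Fin n → ℕ)
    (l : List (Fin n)) (x : EuclideanSpace ℝ (Fin n)) :
    |evP (l.foldl (fun q i => (fun r => pderiv i r)^[κ i] q) p) x| ≤
      (2 * Real.exp 2 * m) ^ (l.map κ).sum * M * ‖x‖ ^ (d - (l.map κ).sum) := by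
  induction l generalizing d p M with
  | nil => simpa using hM x
  | cons i l ih =>
    obtain ⟨hp', hM'⟩ := abs_evP_iterate_pderiv_le (k := κ i) hdm hp hM i
    refine (ih ((Nat.sub_le _ _).trans hdm) hp' hM').trans_eq ?_
    rw [List.map_cons, List.sum_cons, ← Nat.sub_sub, pow_add]
    ring

theorem abs_evP_mpDeriv_le {n d : ℕ} {p : MvPolynomial (Fin n) ℝ}
    (hp : p.IsHomogeneous d) {M : ℝ}
    (hM : ∀ y : EuclideanSpace ℝ (Fin n), |evP p y| ≤ M * ‖y‖ ^ d) (κ : Fin n → ℕ)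
    (x : EuclideanSpace ℝ (Fin n)) :
    |evP (mpDeriv κ p) x| ≤
      (2 * Real.exp 2 * d) ^ (∑ i, κ i) * M * ‖x‖ ^ (d - ∑ i, κ i) := by
  have := abs_evP_foldl_pderiv_le le_rfl hp hM κ (List.finRange n) x
  rwa [← List.ofFn_eq_map, List.sum_ofFn] at this

/-- The space of harmonic homogeneous polynomials of degree `m`. -/
noncomputable def harmonicSubmodule (n m : ℕ) : Submodule ℝ (MvPolynomial (Fin n) ℝ) where
  carrier := {p | p.IsHomogeneous m ∧ mpLap p = 0}
  zero_mem' := ⟨isHomogeneous_zero _ _ _, by simp [mpLap]⟩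
  add_mem' hp hq := ⟨hp.1.add hq.1, by
    have : ∀ p q : MvPolynomial (Fin n) ℝ, mpLap (p + q) = mpLap p + mpLap q := fun p q => by
      simp [mpLap, Finset.sum_add_distrib]
    rw [this, hp.2, hq.2, add_zero]⟩
  smul_mem' c p hp := ⟨(homogeneousSubmodule _ _ _).smul_mem c hp.1, by
    have : mpLap (c • p) = c • mpLap p := by simp [mpLap, Finset.smul_sum]
    rw [this, hp.2, smul_zero]⟩

/-- Precomposition of a polynomial with a linear isometry. -/
noncomputable def compIsometry {n : ℕ}
    (T : EuclideanSpace ℝ (Fin n) ≃ₗᵢ[ℝ] EuclideanSpace ℝ (Fin n))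
    (p : MvPolynomial (Fin n) ℝ) : MvPolynomial (Fin n) ℝ :=
  aeval (fun j => ∑ i, C (T.symm (EuclideanSpace.single j 1) i) * X i) p

theorem evP_compIsometry {n : ℕ}
    (T : EuclideanSpace ℝ (Fin n) ≃ₗᵢ[ℝ] EuclideanSpace ℝ (Fin n))
    (p : MvPolynomial (Fin n) ℝ) (x : EuclideanSpace ℝ (Fin n)) :
    evP (compIsometry T p) x = evP p (T x) := by
  have h : ∀ j, eval (fun i => x i)
      (∑ i, C (T.symm (EuclideanSpace.single j 1) i) * X i) = T x j := by
    intro j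
    have h1 : inner ℝ (T.symm (EuclideanSpace.single j 1)) x = T x j := by
      rw [← T.inner_map_map, T.apply_symm_apply]
      simp [PiLp.inner_apply, PiLp.single_apply]
    rw [← h1]
    simp [PiLp.inner_apply, mul_comm]
  unfold evP compIsometry
  rw [← coe_aeval_eq_eval, ← coe_aeval_eq_eval]
  change aeval _ (aeval _ p) = aeval _ p
  rw [← AlgHom.comp_apply, comp_aeval]
  congr 2
  funext j
  exact h j

theorem mpLap_compIsometry {n : ℕ}
    (T : EuclideanSpace ℝ (Fin n) ≃ₗᵢ[ℝ] EuclideanSpace ℝ (Fin n))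
    (p : MvPolynomial (Fin n) ℝ) : mpLap (compIsometry T p) = compIsometry T (mpLap p) := by
  set A : Fin n → Fin n → ℝ := fun j i => T.symm (EuclideanSpace.single j 1) i with hA
  have hAA : ∀ j k, ∑ i, A k i * A j i = if k = j then 1 else 0 := by
    intro j k
    have h : inner ℝ (T.symm (EuclideanSpace.single j 1)) (T.symm (EuclideanSpace.single k 1))
        = if k = j then (1 : ℝ) else 0 := by
      rw [T.symm.inner_map_map]
      simp [PiLp.inner_apply, PiLp.single_apply, eq_comm]
    rw [← h, PiLp.inner_apply]
    simp [hA]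
  have hd : ∀ q i, pderiv i (compIsometry T q)
      = ∑ j, compIsometry T (pderiv j q) * C (A j i) := by
    intro q i
    unfold compIsometry
    rw [pderiv_aeval]
    refine Finset.sum_congr rfl fun j _ => ?_
    congr 1
    simp [pderiv_X, Pi.single_apply, hA]
  have hL : compIsometry T (mpLap p) = ∑ j, compIsometry T (pderiv j (pderiv j p)) := by
    simp only [compIsometry, mpLap, map_sum]
  rw [hL]
  calc mpLap (compIsometry T p)
      = ∑ i, ∑ j, ∑ k, compIsometry T (pderiv k (pderiv j p)) * C (A k i * A j i) := by
        refine Finset.sum_congr rfl fun i _ => ?_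
        rw [hd, map_sum]
        refine Finset.sum_congr rfl fun j _ => ?_
        rw [pderiv_mul, pderiv_C, mul_zero, add_zero, hd, Finset.sum_mul]
        refine Finset.sum_congr rfl fun k _ => ?_
        rw [C_mul, mul_assoc]
    _ = ∑ j, ∑ k, compIsometry T (pderiv k (pderiv j p)) * C (∑ i, A k i * A j i) := by
        rw [Finset.sum_comm]
        refine Finset.sum_congr rfl fun j _ => ?_
        rw [Finset.sum_comm]
        refine Finset.sum_congr rfl fun k _ => ?_
        rw [map_sum, Finset.mul_sum]
    _ = _ := by
        refine Finset.sum_congr rfl fun j _ => ?_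
        rw [Finset.sum_eq_single j]
        · simp [hAA]
        · intro k _ hk
          simp [hAA, hk]
        · simp

theorem compIsometry_mem {n m : ℕ}
    (T : EuclideanSpace ℝ (Fin n) ≃ₗᵢ[ℝ] EuclideanSpace ℝ (Fin n))
    {p : MvPolynomial (Fin n) ℝ} (hp : p ∈ harmonicSubmodule n m) :
    compIsometry T p ∈ harmonicSubmodule n m := by
  refine ⟨?_, ?_⟩
  · have := hp.1.aeval (fun j => ∑ i, C (T.symm (EuclideanSpace.single j 1) i) * X i) (n := 1)
      fun j => IsHomogeneous.sum _ _ _ fun i _ => by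
        simpa using (isHomogeneous_C _ _).mul (isHomogeneous_X ℝ i)
    rwa [one_mul] at this
  · rw [mpLap_compIsometry, hp.2]
    simp [compIsometry]

theorem coeff_mpLap {n : ℕ} (p : MvPolynomial (Fin n) ℝ) (b : Fin n →₀ ℕ) :
    coeff b (mpLap p) = ∑ i, coeff (b + Finsupp.single i 1 + Finsupp.single i 1) p
      * ((b i + 2) * (b i + 1)) := by
  rw [mpLap, coeff_sum]
  refine Finset.sum_congr rfl fun i _ => ?_
  rw [coeff_pderiv, coeff_pderiv]
  simp
  ring

/-- The exponents of total degree `m` whose first entry is `t`, parametrized by the entries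
other than the first two. -/
noncomputable def lowExponent (N m : ℕ) (s : Fin 2 × (Fin N → Fin (m + 1))) :
    Fin (N + 2) →₀ ℕ :=
  Finsupp.equivFunOnFinite.symm
    (Fin.cons (s.1 : ℕ) (Fin.cons (m - s.1 - ∑ i, (s.2 i : ℕ)) fun i => (s.2 i : ℕ)))

/-- A harmonic homogeneous polynomial is determined by the coefficients whose exponent of the
first variable is at most one. -/
theorem coeff_eq_zero_of_harmonic {N m : ℕ} {p : MvPolynomial (Fin (N + 2)) ℝ}
    (hp : p ∈ harmonicSubmodule (N + 2) m) (h : ∀ s, coeff (lowExponent N m s) p = 0) (t : ℕ) :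
    ∀ a : Fin (N + 2) →₀ ℕ, a 0 = t → coeff a p = 0 := by
  induction t using Nat.strong_induction_on with
  | _ t ih =>
    intro a ha
    rcases lt_or_ge t 2 with ht | ht
    · by_contra hne
      have hdeg : ∑ i, a i = m := by
        rw [← Finsupp.degree_eq_sum, Finsupp.degree_eq_weight_one]
        exact hp.1 hne
      rw [Fin.sum_univ_succ, Fin.sum_univ_succ] at hdeg
      have hlt : ∀ i : Fin N, a i.succ.succ < m + 1 := fun i => by
        have : a i.succ.succ ≤ ∑ i : Fin N, a i.succ.succ :=
          Finset.single_le_sum (f := fun i : Fin N => a i.succ.succ)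
            (fun _ _ => Nat.zero_le _) (Finset.mem_univ i)
        omega
      refine hne ?_
      convert h (⟨t, ht⟩, fun i => ⟨a i.succ.succ, hlt i⟩) using 2
      ext i
      simp only [lowExponent, Finsupp.equivFunOnFinite_symm_apply_apply]
      refine Fin.cases ?_ (fun i => Fin.cases ?_ (fun i => ?_) i) i
      · simpa using ha
      · simp only [Fin.cons_succ, Fin.cons_zero]
        omega
      · simp
    · set b : Fin (N + 2) →₀ ℕ := a - Finsupp.single 0 2 with hb
      have hab : b + Finsupp.single 0 1 + Finsupp.single 0 1 = a := by
        rw [add_assoc, ← Finsupp.single_add]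
        exact tsub_add_cancel_of_le (Finsupp.single_le_iff.2 (by omega))
      have hb0 : b 0 = t - 2 := by simp [hb, ha]
      have h0 := coeff_mpLap p b
      rw [hp.2, coeff_zero, Finset.sum_eq_single 0, hab] at h0
      · have : ((b 0 : ℝ) + 2) * (b 0 + 1) ≠ 0 := by positivity
        exact (mul_eq_zero.1 h0.symm).resolve_right this
      · intro i _ hi
        rw [ih (t - 2) (by omega) _ (by simp [hb0, hi]), zero_mul]
      · simp

theorem finrank_harmonicSubmodule_le (N m : ℕ) :
    Module.Finite ℝ (harmonicSubmodule (N + 2) m) ∧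
      Module.finrank ℝ (harmonicSubmodule (N + 2) m) ≤ 2 * (m + 1) ^ N := by
  set φ : harmonicSubmodule (N + 2) m →ₗ[ℝ] (Fin 2 × (Fin N → Fin (m + 1)) → ℝ) :=
    LinearMap.pi fun s => (lcoeff ℝ (lowExponent N m s)).comp (Submodule.subtype _)
  have hφ : Function.Injective φ := by
    rw [← LinearMap.ker_eq_bot, LinearMap.ker_eq_bot']
    intro p h
    refine Subtype.ext (MvPolynomial.ext _ _ fun a => ?_)
    exact coeff_eq_zero_of_harmonic p.2 (fun s => congrFun h s) _ a rfl
  refine ⟨Module.Finite.of_injective φ hφ, ?_⟩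
  refine (LinearMap.finrank_le_finrank_of_injective hφ).trans_eq ?_
  simp

/-- The `L²` inner product on harmonic homogeneous polynomials. -/
noncomputable def sphForm (n m : ℕ) : LinearMap.BilinForm ℝ (harmonicSubmodule n m) :=
  have hi : ∀ p q : MvPolynomial (Fin n) ℝ,
      Integrable (fun ζ : Metric.sphere (0 : EuclideanSpace ℝ (Fin n)) 1 => evP p ζ * evP q ζ)
        (sphMeasure n) := fun p q => integrable_sphMeasure (continuous_evP_mul_evP p q)
  LinearMap.mk₂ ℝ (fun p q => ∫ ζ, evP p.1 ζ * evP q.1 ζ ∂sphMeasure n)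
    (fun p p' q => by
      rw [← integral_add (hi _ _) (hi _ _)]
      simp [evP, add_mul])
    (fun c p q => by
      rw [smul_eq_mul, ← integral_const_mul]
      simp [evP, mul_assoc, smul_eval])
    (fun p q q' => by
      rw [← integral_add (hi _ _) (hi _ _)]
      simp [evP, mul_add])
    (fun c p q => by
      rw [smul_eq_mul, ← integral_const_mul]
      simp [evP, mul_left_comm, smul_eval])

theorem sphForm_apply {n m : ℕ} (p q : harmonicSubmodule n m) :
    sphForm n m p q = ∫ ζ, evP p.1 ζ * evP q.1 ζ ∂sphMeasure n := rfl

namespace IsZonalHarmonic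

variable {n : ℕ} {Z : ℕ → EuclideanSpace ℝ (Fin n) → MvPolynomial (Fin n) ℝ}

theorem mem (hZ : IsZonalHarmonic n Z) (m : ℕ) (y : EuclideanSpace ℝ (Fin n)) :
    Z m y ∈ harmonicSubmodule n m :=
  ⟨hZ.hom m y, hZ.harm m y⟩

theorem repro' (hZ : IsZonalHarmonic n Z) {m : ℕ} {p : MvPolynomial (Fin n) ℝ}
    (hp : p ∈ harmonicSubmodule n m) (η : Metric.sphere (0 : EuclideanSpace ℝ (Fin n)) 1) :
    ∫ ζ : Metric.sphere (0 : EuclideanSpace ℝ (Fin n)) 1, evP p ζ * evP (Z m η) ζ ∂sphMeasure n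
      = evP p η :=
  hZ.repro m p hp.2 hp.1 η

theorem sq_le (hZ : IsZonalHarmonic n Z) {m : ℕ} {p : MvPolynomial (Fin n) ℝ}
    (hp : p ∈ harmonicSubmodule n m) (η : Metric.sphere (0 : EuclideanSpace ℝ (Fin n)) 1) :
    evP p η ^ 2 ≤ (∫ ζ : Metric.sphere (0 : EuclideanSpace ℝ (Fin n)) 1,
      evP p ζ * evP p ζ ∂sphMeasure n) * evP (Z m η) η := by
  let P : harmonicSubmodule n m := ⟨p, hp⟩
  let Q : harmonicSubmodule n m := ⟨Z m η, hZ.mem m η⟩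
  have hPQ : sphForm n m P Q = evP p η := hZ.repro' hp η
  have hQQ : sphForm n m Q Q = evP (Z m η) η := hZ.repro' (hZ.mem m η) η
  have hQP : sphForm n m Q P = evP p η := by
    rw [← hPQ, sphForm_apply, sphForm_apply]
    simp_rw [mul_comm]
  have hnn : ∀ R : harmonicSubmodule n m, 0 ≤ sphForm n m R R := fun R =>
    integral_nonneg fun ζ => mul_self_nonneg _
  have := (sphForm n m).apply_mul_apply_le_of_forall_zero_le hnn P Q
  rw [hPQ, hQP, hQQ, ← sq] at this
  exact this

theorem diag_nonneg (hZ : IsZonalHarmonic n Z) (m : ℕ)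
    (η : Metric.sphere (0 : EuclideanSpace ℝ (Fin n)) 1) : 0 ≤ evP (Z m η) η := by
  rw [← hZ.repro' (hZ.mem m η) η]
  exact integral_nonneg fun ζ => mul_self_nonneg _

/-- The diagonal value of the zonal harmonic does not depend on the pole. -/
theorem diag_le (hZ : IsZonalHarmonic n Z) (m : ℕ)
    (η ξ : Metric.sphere (0 : EuclideanSpace ℝ (Fin n)) 1) :
    evP (Z m ξ) ξ ≤ evP (Z m η) η := by
  obtain ⟨T, hT⟩ : ∃ T : EuclideanSpace ℝ (Fin n) ≃ₗᵢ[ℝ] EuclideanSpace ℝ (Fin n),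
      T η = ξ := ⟨_, Submodule.reflection_sub (by simp)⟩
  have h := hZ.sq_le (compIsometry_mem T (hZ.mem m ξ)) η
  have hint : ∫ ζ : Metric.sphere (0 : EuclideanSpace ℝ (Fin n)) 1,
      evP (compIsometry T (Z m ξ)) ζ * evP (compIsometry T (Z m ξ)) ζ ∂sphMeasure n
      = evP (Z m ξ) ξ := by
    rw [← hZ.repro' (hZ.mem m ξ) ξ]
    simp_rw [evP_compIsometry]
    have hmp := measurePreserving_sphMap T
    conv_rhs => rw [← hmp.map_eq]
    rw [integral_map hmp.aemeasurable (continuous_evP_mul_evP _ _).aestronglyMeasurable]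
    rfl
  rw [hint, evP_compIsometry, hT] at h
  rcases (hZ.diag_nonneg m ξ).eq_or_lt with h1 | h1
  · rw [← h1]
    exact hZ.diag_nonneg m η
  · nlinarith

end IsZonalHarmonic

theorem IsZonalHarmonic.diag_le_two_mul_pow {N : ℕ}
    {Z : ℕ → EuclideanSpace ℝ (Fin (N + 2)) → MvPolynomial (Fin (N + 2)) ℝ}
    (hZ : IsZonalHarmonic (N + 2) Z) (m : ℕ)
    (η : Metric.sphere (0 : EuclideanSpace ℝ (Fin (N + 2))) 1) :
    evP (Z m η) η ≤ 2 * (m + 1) ^ N := by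
  have := isProbabilityMeasure_sphMeasure (n := N + 2) (by omega)
  obtain ⟨hfin, hrank⟩ := finrank_harmonicSubmodule_le N m
  set B := sphForm (N + 2) m with hB
  have hsymm : LinearMap.IsSymm B := ⟨fun p q => by
    simp only [hB, sphForm_apply, RingHom.id_apply]
    simp_rw [mul_comm]⟩
  obtain ⟨v, hv⟩ := LinearMap.BilinForm.exists_orthogonal_basis hsymm
  have hdiag : ∀ ξ : Metric.sphere (0 : EuclideanSpace ℝ (Fin (N + 2))) 1,
      evP (Z m ξ) ξ = ∑ j, evP (v j).1 ξ * evP (v j).1 ξ / B (v j) (v j) := by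
    intro ξ
    let Q : harmonicSubmodule (N + 2) m := ⟨Z m ξ, hZ.mem m ξ⟩
    have hc : ∀ j, evP (v j).1 ξ = v.repr Q j * B (v j) (v j) := by
      intro j
      rw [← hZ.repro' (v j).2 ξ]
      change B (v j) Q = _
      conv_lhs => rw [← v.sum_repr Q]
      rw [map_sum, Finset.sum_eq_single j]
      · simp
      · intro i _ hij
        rw [map_smul, hv hij.symm, smul_zero]
      · simp
    have hQ : evP (Z m ξ) ξ = ∑ j, v.repr Q j * evP (v j).1 ξ := by
      have : Z m ξ = ((∑ j, v.repr Q j • v j : harmonicSubmodule (N + 2) m) :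
          MvPolynomial (Fin (N + 2)) ℝ) := by rw [v.sum_repr Q]
      rw [this]
      simp only [AddSubmonoidClass.coe_finsetSum, SetLike.val_smul, evP, map_sum, smul_eval]
    rw [hQ]
    refine Finset.sum_congr rfl fun j _ => ?_
    by_cases h0 : B (v j) (v j) = 0
    · simp [hc j, h0]
    · rw [eq_div_iff h0]
      conv_rhs => rw [hc j]
      rw [hc j]
      ring
  have hint : ∫ ξ : Metric.sphere (0 : EuclideanSpace ℝ (Fin (N + 2))) 1,
      evP (Z m ξ) ξ ∂sphMeasure (N + 2) ≤ 2 * (m + 1) ^ N := by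
    simp_rw [hdiag]
    rw [integral_finsetSum _ fun j _ =>
      (integrable_sphMeasure (continuous_evP_mul_evP _ _)).div_const _]
    calc _ = ∑ j, B (v j) (v j) / B (v j) (v j) := by
          refine Finset.sum_congr rfl fun j _ => ?_
          rw [integral_div]
          rfl
      _ ≤ ∑ j : Fin (Module.finrank ℝ (harmonicSubmodule (N + 2) m)), (1 : ℝ) :=
          Finset.sum_le_sum fun j _ => div_self_le_one _
      _ ≤ _ := by
          simp only [Finset.sum_const, Finset.card_univ, Fintype.card_fin, nsmul_eq_mul, mul_one]
          exact_mod_cast hrank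
  have hconst : ∀ ξ : Metric.sphere (0 : EuclideanSpace ℝ (Fin (N + 2))) 1,
      evP (Z m ξ) ξ = evP (Z m η) η := fun ξ => le_antisymm (hZ.diag_le m η ξ) (hZ.diag_le m ξ η)
  simpa [hconst] using hint

theorem IsZonalHarmonic.abs_le {N : ℕ}
    {Z : ℕ → EuclideanSpace ℝ (Fin (N + 2)) → MvPolynomial (Fin (N + 2)) ℝ}
    (hZ : IsZonalHarmonic (N + 2) Z) (m : ℕ) (x y : EuclideanSpace ℝ (Fin (N + 2))) :
    |evP (Z m y) x| ≤ 2 * (m + 1) ^ N * ‖y‖ ^ m * ‖x‖ ^ m := by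
  have hsph : ∀ η ξ : Metric.sphere (0 : EuclideanSpace ℝ (Fin (N + 2))) 1,
      |evP (Z m η) ξ| ≤ 2 * (m + 1) ^ N := by
    intro η ξ
    refine abs_le_of_sq_le_sq ?_ (by positivity)
    refine (hZ.sq_le (hZ.mem m η) ξ).trans ?_
    rw [hZ.repro' (hZ.mem m η) η, sq]
    exact mul_le_mul (hZ.diag_le_two_mul_pow m η) (hZ.diag_le_two_mul_pow m ξ)
      (hZ.diag_nonneg m ξ) (by positivity)
  have hpolar : ∀ z : EuclideanSpace ℝ (Fin (N + 2)),
      ∃ u : Metric.sphere (0 : EuclideanSpace ℝ (Fin (N + 2))) 1, z = ‖z‖ • (u : _) := by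
    intro z
    obtain ⟨u, hu, h⟩ := exists_unit_smul z
    exact ⟨⟨u, by simpa using hu⟩, h⟩
  obtain ⟨ξ, hξ⟩ := hpolar x
  obtain ⟨η, hη⟩ := hpolar y
  rw [hη, hZ.scale m _ (norm_nonneg _), ← hη, hξ, evP_smul (hZ.hom m _), ← hξ, abs_mul, abs_mul,
    abs_pow, abs_pow, abs_norm, abs_norm]
  calc _ ≤ ‖y‖ ^ m * (‖x‖ ^ m * (2 * (m + 1) ^ N)) := by
        gcongr
        exact hsph η ξ
    _ = _ := by ring

theorem stmt_19 {n : ℕ} (hn : 2 ≤ n) (k : ℕ) (hk : 1 ≤ k)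
    (Z : ℕ → EuclideanSpace ℝ (Fin n) → MvPolynomial (Fin n) ℝ)
    (hZ : IsZonalHarmonic n Z) :
    ∃ C > 0, ∀ κ : Fin n → ℕ, (∑ i, κ i) = k → ∀ m : ℕ, k ≤ m →
      ∀ x y : EuclideanSpace ℝ (Fin n), ‖x‖ < 1 → ‖y‖ < 1 →
        |evP (mpDeriv κ (Z m y)) x|
          ≤ C * (m : ℝ) ^ (n - 2 + k) * ‖x‖ ^ (m - k) * ‖y‖ ^ m := by
  obtain ⟨N, rfl⟩ : ∃ N, n = N + 2 := ⟨n - 2, by omega⟩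
  refine ⟨(2 * Real.exp 2) ^ k * (2 * 2 ^ N), by positivity, fun κ hκ m hm x y _ _ => ?_⟩
  have h := abs_evP_mpDeriv_le (hZ.hom m y) (fun x => hZ.abs_le m x y) κ x
  rw [hκ] at h
  refine h.trans ?_
  have hm1 : (1 : ℝ) ≤ m := by exact_mod_cast hk.trans hm
  calc _ ≤ (2 * Real.exp 2 * m) ^ k * (2 * (m + m) ^ N * ‖y‖ ^ m) * ‖x‖ ^ (m - k) := by gcongr
    _ = _ := by
        rw [Nat.add_sub_cancel, ← two_mul, mul_pow, mul_pow 2 (m : ℝ), pow_add]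
        ring
end
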